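/- Fix an integer k ≥ 4. Let (m_j) and (n_j) be sequences of positive integers tending to infinity with m_j/n_j → c ∈ (2/k, 1). Then there is a constant K such that for all sufficiently large j, ∑_{ℓ=2}^{m_j} E[Y^{(ℓ)}_{m_j,n_j}] ≤ K · m_j^{−(k−2)}, where E[Y^{(ℓ)}_{m,n}] is the average over uniformly random C ∈ C_{m,n} of the number of even ℓ-subsets of rows of C. -/

import Mathlib

open scoped Classical

/-- `C_{m,n}`: allocations of `k` distinguishable chips per row (over `m` rows)
to `n` columns, such that every column receives at least `2` chips. -/
noncomputable def chipSet (k m n : ℕ) : Finset (Fin m × Fin k → Fin n) :=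
  Finset.univ.filter (fun φ =>
    ∀ j : Fin n, 2 ≤ (Finset.univ.filter (fun p : Fin m × Fin k => φ p = j)).card)

/-- The number of `ℓ`-element sets of rows of `C = φ` whose column sums are all even. -/
noncomputable def Ycount (k m n ℓ : ℕ) (φ : Fin m × Fin k → Fin n) : ℕ :=
  (Finset.univ.filter (fun S : Finset (Fin m) =>
    S.card = ℓ ∧ ∀ j : Fin n,
      Even (∑ i ∈ S, (Finset.univ.filter (fun u : Fin k => φ (i, u) = j)).card))).card

/-- `E[Y^{(ℓ)}]`: the average of `Ycount` over a uniformly random `C ∈ C_{m,n}`. -/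
noncomputable def EY (k m n ℓ : ℕ) : ℝ :=
  (∑ φ ∈ chipSet k m n, (Ycount k m n ℓ φ : ℝ)) / ((chipSet k m n).card : ℝ)

namespace XS

noncomputable def ff (z : ℝ) : ℝ := Real.exp z - 1 - z
noncomputable def gg (l : ℝ) : ℝ := l * (Real.exp l - 1) / ff l
noncomputable def RR (l t : ℝ) : ℝ := ff (t * l) / ff l

lemma ff_pos {z : ℝ} (hz : z ≠ 0) : 0 < ff z := by
  have := Real.add_one_lt_exp hz
  unfold ff; linarith

lemma ff_nonneg (z : ℝ) : 0 ≤ ff z := by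
  have := Real.add_one_le_exp z
  unfold ff; linarith

lemma hasSum_exp (l : ℝ) : HasSum (fun i : ℕ => l ^ i / (i.factorial : ℝ)) (Real.exp l) := by
  rw [Real.exp_eq_exp_ℝ]; exact NormedSpace.expSeries_div_hasSum_exp l

lemma hs_congr {f g : ℕ → ℝ} {a b : ℝ} (h : HasSum f a) (hfg : ∀ i, f i = g i) (hab : a = b) :
    HasSum g b := by
  have : f = g := funext hfg
  subst this; subst hab; exact h

lemma hasSum_ff (l : ℝ) : HasSum (fun i : ℕ => l ^ (i + 2) / ((i + 2).factorial : ℝ)) (ff l) := by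
  have h := (hasSum_nat_add_iff' (f := fun i : ℕ => l ^ i / (i.factorial : ℝ)) 2).mpr (hasSum_exp l)
  refine hs_congr h (fun i => rfl) ?_
  simp [ff, Finset.sum_range_succ]; ring

lemma hasSum_ff_mul (l t : ℝ) :
    HasSum (fun i : ℕ => t ^ (i + 2) * (l ^ (i + 2) / ((i + 2).factorial : ℝ))) (ff (t * l)) := by
  have h := hasSum_ff (t * l)
  refine hs_congr h (fun i => ?_) rfl
  rw [mul_pow]; ring

lemma hasSum_gg (l : ℝ) : HasSum (fun i : ℕ => ((i : ℝ) + 2) * (l ^ (i + 2) / ((i + 2).factorial : ℝ)))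
    (l * (Real.exp l - 1)) := by
  have h := (hasSum_nat_add_iff' (f := fun i : ℕ => l ^ i / (i.factorial : ℝ)) 1).mpr (hasSum_exp l)
  have h2 := h.mul_left l
  refine hs_congr h2 (fun i => ?_) ?_
  · have : ((i + 2).factorial : ℝ) = ((i : ℝ) + 2) * ((i + 1).factorial : ℝ) := by
      rw [Nat.factorial_succ (i + 1)]; push_cast; ring
    rw [this]
    have h1 : ((i + 1).factorial : ℝ) ≠ 0 := by positivity
    have h3 : ((i : ℝ) + 2) ≠ 0 := by positivity
    field_simp
    ring
  · simp

lemma sign_lemma (w : ℕ → ℝ) (hw : ∀ i, w i < 0 → ∀ j, i ≤ j → w j ≤ 0) {L l S s : ℝ} (hl : 0 < l)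
    (hlL : l ≤ L) (hS : HasSum (fun i : ℕ => w i * (L ^ (i + 2) / ((i + 2).factorial : ℝ))) S)
    (hs : HasSum (fun i : ℕ => w i * (l ^ (i + 2) / ((i + 2).factorial : ℝ))) s) (hS0 : 0 ≤ S) :
    0 ≤ s := by
  by_cases hex : ∃ i, w i < 0
  · set x0 := Nat.find hex
    have hx0 : w x0 < 0 := Nat.find_spec hex
    have hlt : ∀ i, i < x0 → 0 ≤ w i := fun i hi => not_lt.mp (Nat.find_min hex hi)
    have hL : 0 < L := lt_of_lt_of_le hl hlL
    set q := l / L with hq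
    have hq0 : 0 < q := by positivity
    have hq1 : q ≤ 1 := by rw [hq, div_le_one hL]; exact hlL
    have hlq : l = q * L := by rw [hq]; field_simp
    have hcmp : ∀ i, q ^ (x0 + 2) * (w i * (L ^ (i + 2) / ((i + 2).factorial : ℝ))) ≤
        w i * (l ^ (i + 2) / ((i + 2).factorial : ℝ)) := by
      intro i
      have hp : 0 ≤ L ^ (i + 2) / ((i + 2).factorial : ℝ) := by positivity
      have e : w i * (l ^ (i + 2) / ((i + 2).factorial : ℝ)) =
          (w i * q ^ (i + 2)) * (L ^ (i + 2) / ((i + 2).factorial : ℝ)) := by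
        rw [hlq, mul_pow]; ring
      rw [e, ← mul_assoc]
      apply mul_le_mul_of_nonneg_right _ hp
      rw [mul_comm]
      rcases lt_or_ge i x0 with h | h
      · exact mul_le_mul_of_nonneg_left (pow_le_pow_of_le_one hq0.le hq1 (by omega)) (hlt i h)
      · exact mul_le_mul_of_nonpos_left (pow_le_pow_of_le_one hq0.le hq1 (by omega)) (hw _ hx0 _ h)
    have := hasSum_le hcmp (hS.mul_left (q ^ (x0 + 2))) hs
    exact le_trans (by positivity) this
  · push Not at hex
    exact hs.nonneg (fun i => mul_nonneg (hex i) (by positivity))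

lemma RR_anti {t l L : ℝ} (ht0 : 0 ≤ t) (ht1 : t ≤ 1) (hl : 0 < l) (hlL : l ≤ L) :
    RR L t ≤ RR l t := by
  have hL : 0 < L := lt_of_lt_of_le hl hlL
  have hfL := ff_pos hL.ne'
  have hfl := ff_pos hl.ne'
  have key := sign_lemma (fun i => t ^ (i + 2) - RR L t) (by
      intro i hi j hij
      have : t ^ (j + 2) ≤ t ^ (i + 2) := pow_le_pow_of_le_one ht0 ht1 (by omega)
      show t ^ (j + 2) - RR L t ≤ 0
      linarith) (L := L) (l := l) (S := ff (t * L) - RR L t * ff L) (s := ff (t * l) - RR L t * ff l) hl hlL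
    (by simp only [sub_mul]; exact (hasSum_ff_mul L t).sub ((hasSum_ff L).mul_left _))
    (by simp only [sub_mul]; exact (hasSum_ff_mul l t).sub ((hasSum_ff l).mul_left _))
    (by unfold RR; rw [div_mul_cancel₀ _ hfL.ne']; simp)
  rw [show RR l t = ff (t * l) / ff l from rfl, le_div_iff₀ hfl]
  linarith

lemma RR_chord {t l L : ℝ} (ht0 : 0 ≤ t) (ht1 : t ≤ 1) (hl : 0 < l) (hlL : l ≤ L) (hg : 2 < gg L) :
    RR l t ≤ t ^ 2 - (gg l - 2) * ((t ^ 2 - RR L t) / (gg L - 2)) := by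
  have hL : 0 < L := lt_of_lt_of_le hl hlL
  have hfL := ff_pos hL.ne'
  have hfl := ff_pos hl.ne'
  set κ := (t ^ 2 - RR L t) / (gg L - 2) with hκ
  have hsum : ∀ x : ℝ, HasSum (fun i : ℕ => (t ^ 2 - t ^ (i + 2) - κ * i) * (x ^ (i + 2) / ((i + 2).factorial : ℝ)))
      (t ^ 2 * ff x - ff (t * x) - κ * (x * (Real.exp x - 1) - 2 * ff x)) := by
    intro x
    have h1 := ((hasSum_ff x).mul_left (t ^ 2)).sub (hasSum_ff_mul x t)
    have h2 := ((hasSum_gg x).sub ((hasSum_ff x).mul_left 2)).mul_left κ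
    exact hs_congr (h1.sub h2) (fun i => by ring) rfl
  have key := sign_lemma (fun i => t ^ 2 - t ^ (i + 2) - κ * i) (by
      intro i hi j hij
      induction j, hij using Nat.le_induction with
      | base => exact hi.le
      | succ j hij ih =>
        have hi1 : 1 ≤ i := by
          rcases Nat.eq_zero_or_pos i with h | h
          · subst h; simp at hi
          · exact h
        have hj1 : (1 : ℝ) ≤ j := by exact_mod_cast hi1.trans hij
        beta_reduce at ih hi ⊢
        -- j * (1-t) t^j ≤ 1 - t^j
        have hgeo : ∀ j : ℕ, (j : ℝ) * (1 - t) * t ^ j ≤ 1 - t ^ j := by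
          intro j
          induction j with
          | zero => simp
          | succ p ihp =>
            have h1 : 0 ≤ t ^ p := by positivity
            have h0 : t * t ^ p ≤ t ^ p := by nlinarith
            have h2 : (p : ℝ) * (1 - t) * t ^ (p + 1) ≤ (p : ℝ) * (1 - t) * t ^ p := by
              rw [pow_succ']
              apply mul_le_mul_of_nonneg_left h0
              apply mul_nonneg (by positivity) (by linarith)
            have h3 : (1 - t) * t ^ (p + 1) ≤ (1 - t) * t ^ p := by
              rw [pow_succ']
              apply mul_le_mul_of_nonneg_left h0 (by linarith)
            have e : t ^ (p + 1) = t * t ^ p := pow_succ' _ _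
            push_cast
            nlinarith
        have hg := hgeo j
        have e1 : t ^ (j + 2) = t ^ 2 * t ^ j := by ring
        have e2 : t ^ (j + 1 + 2) = t ^ 2 * t ^ j * t := by ring
        rw [e1] at ih
        rw [e2]
        push_cast
        have h4 : t ^ 2 * ((j : ℝ) * (1 - t) * t ^ j) ≤ t ^ 2 * (1 - t ^ j) :=
          mul_le_mul_of_nonneg_left hg (by positivity)
        have h5 : (j : ℝ) * (t ^ 2 * (1 - t) * t ^ j) ≤ j * κ := by nlinarith
        have h6 : t ^ 2 * (1 - t) * t ^ j ≤ κ := le_of_mul_le_mul_left h5 (by linarith)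
        nlinarith) hl hlL (hsum L) (hsum l) (by
      have e1 : L * (Real.exp L - 1) = gg L * ff L := by unfold gg; rw [div_mul_cancel₀ _ hfL.ne']
      have e2 : ff (t * L) = RR L t * ff L := by unfold RR; rw [div_mul_cancel₀ _ hfL.ne']
      rw [e1, e2]
      have : κ * (gg L - 2) = t ^ 2 - RR L t := by
        rw [hκ]; exact div_mul_cancel₀ _ (by linarith)
      have e3 : t ^ 2 * ff L - RR L t * ff L - κ * (gg L * ff L - 2 * ff L) =
        (t ^ 2 - RR L t - κ * (gg L - 2)) * ff L := by ring
      rw [e3, this]; simp)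
  have e1 : l * (Real.exp l - 1) = gg l * ff l := by unfold gg; rw [div_mul_cancel₀ _ hfl.ne']
  rw [e1] at key
  rw [show RR l t = ff (t * l) / ff l from rfl, div_le_iff₀ hfl]
  nlinarith

end XS

namespace XS

lemma gg_mono {l L : ℝ} (hl : 0 < l) (hlL : l ≤ L) : gg l ≤ gg L := by
  have hL : 0 < L := lt_of_lt_of_le hl hlL
  have hfL := ff_pos hL.ne'
  have hfl := ff_pos hl.ne'
  have hsum : ∀ x : ℝ, HasSum (fun i : ℕ => (gg L - ((i : ℝ) + 2)) * (x ^ (i + 2) / ((i + 2).factorial : ℝ)))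
      (gg L * ff x - x * (Real.exp x - 1)) := by
    intro x
    simp only [sub_mul]; exact ((hasSum_ff x).mul_left _).sub (hasSum_gg x)
  have key := sign_lemma (fun i => gg L - ((i : ℝ) + 2)) (by
    intro i hi j hij
    have : (i : ℝ) ≤ j := by exact_mod_cast hij
    beta_reduce at hi ⊢
    linarith) hl hlL (hsum L) (hsum l) (by
      unfold gg; rw [div_mul_cancel₀ _ hfL.ne']; simp)
  rw [show gg l = l * (Real.exp l - 1) / ff l from rfl, div_le_iff₀ hfl]
  linarith

lemma hasDerivAt_ff (z : ℝ) : HasDerivAt ff (Real.exp z - 1) z := by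
  unfold ff
  exact ((Real.hasDerivAt_exp z).sub_const 1).sub (hasDerivAt_id z)

lemma ff_cont : Continuous ff := by unfold ff; fun_prop

lemma cosh_gt {l : ℝ} (hl : 0 < l) : l ^ 2 + 2 < Real.exp l + Real.exp (-l) := by
  have h1 : l / 2 < Real.sinh (l / 2) := Real.self_lt_sinh_iff.mpr (by linarith)
  have h2 : Real.exp l + Real.exp (-l) = 2 + 4 * Real.sinh (l/2) ^ 2 := by
    rw [Real.sinh_eq]
    have e1 : Real.exp l = Real.exp (l/2) * Real.exp (l/2) := by rw [← Real.exp_add]; ring_nf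
    have e2 : Real.exp (-l) = Real.exp (-(l/2)) * Real.exp (-(l/2)) := by rw [← Real.exp_add]; ring_nf
    have e3 : Real.exp (l/2) * Real.exp (-(l/2)) = 1 := by rw [← Real.exp_add]; simp
    rw [e1, e2]; nlinarith
  rw [h2]; nlinarith

lemma gg_strictMono : StrictMonoOn gg (Set.Ioi 0) := by
  have hd : ∀ x ∈ Set.Ioi (0:ℝ), HasDerivAt gg
      (((1 * (Real.exp x - 1) + x * Real.exp x) * ff x - x * (Real.exp x - 1) * (Real.exp x - 1)) / ff x ^ 2) x := by
    intro x hx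
    have hx : 0 < x := hx
    have h1 : HasDerivAt (fun l => l * (Real.exp l - 1)) (1 * (Real.exp x - 1) + x * Real.exp x) x :=
      (hasDerivAt_id x).mul ((Real.hasDerivAt_exp x).sub_const 1)
    exact h1.div (hasDerivAt_ff x) (ff_pos hx.ne').ne'
  apply strictMonoOn_of_deriv_pos (convex_Ioi 0)
  · intro x hx; exact (hd x hx).continuousAt.continuousWithinAt
  · intro x hx
    rw [interior_Ioi] at hx
    rw [(hd x hx).deriv]
    have hx : 0 < x := hx
    apply div_pos _ (pow_pos (ff_pos hx.ne') 2)
    have := cosh_gt hx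
    have e3 : Real.exp x * Real.exp (-x) = 1 := by rw [← Real.exp_add]; simp
    have h4 := mul_lt_mul_of_pos_left this (Real.exp_pos x)
    rw [mul_add (Real.exp x) (Real.exp x), e3] at h4
    unfold ff
    nlinarith

lemma gg_contAt {x : ℝ} (hx : 0 < x) : ContinuousAt gg x := by
  unfold gg
  apply ContinuousAt.div
  · fun_prop
  · exact ff_cont.continuousAt
  · exact (ff_pos hx.ne').ne'

lemma gg_le {l : ℝ} (hl : 0 < l) : gg l ≤ 2 + l := by
  unfold gg
  rw [div_le_iff₀ (ff_pos hl.ne')]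
  have := Real.quadratic_le_exp_of_nonneg hl.le
  unfold ff; nlinarith

lemma le_gg {l : ℝ} (hl : 0 < l) : l ≤ gg l := by
  unfold gg
  rw [le_div_iff₀ (ff_pos hl.ne')]
  unfold ff; nlinarith

lemma two_lt_gg {l : ℝ} (hl : 0 < l) : 2 < gg l := by
  unfold gg
  rw [lt_div_iff₀ (ff_pos hl.ne')]
  refine hasSum_lt (i := 1) ?_ ?_ ((hasSum_ff l).mul_left 2) (hasSum_gg l)
  · intro i
    apply mul_le_mul_of_nonneg_right _ (by positivity)
    have : (0:ℝ) ≤ i := by positivity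
    linarith
  · apply mul_lt_mul_of_pos_right _ (by positivity)
    norm_num

lemma exists_gg {G : ℝ} (hG : 2 < G) : ∃ l, 0 < l ∧ gg l = G := by
  have h1 : gg (G - 2) ≤ G := by have := gg_le (l := G - 2) (by linarith); linarith
  have h2 : G ≤ gg G := le_gg (by linarith)
  have hc : ContinuousOn gg (Set.Icc (G - 2) G) := fun x hx =>
    (gg_contAt (by linarith [hx.1])).continuousWithinAt
  obtain ⟨l, hl, he⟩ := intermediate_value_Icc (by linarith) hc ⟨h1, h2⟩
  exact ⟨l, by linarith [hl.1], he⟩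

lemma RR_nonneg (l t : ℝ) : 0 ≤ RR l t := div_nonneg (ff_nonneg _) (ff_nonneg _)

lemma RR_le_sq {l t : ℝ} (hl : 0 < l) (ht0 : 0 ≤ t) (ht1 : t ≤ 1) : RR l t ≤ t ^ 2 := by
  unfold RR
  rw [div_le_iff₀ (ff_pos hl.ne')]
  refine hasSum_le ?_ (hasSum_ff_mul l t) ((hasSum_ff l).mul_left _)
  intro i
  apply mul_le_mul_of_nonneg_right _ (by positivity)
  exact pow_le_pow_of_le_one ht0 ht1 (by omega)

lemma ff_neg_le {u : ℝ} (hu : 0 ≤ u) : ff (-u) ≤ ff u := by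
  have := Real.self_le_sinh_iff.mpr hu
  rw [Real.sinh_eq] at this
  unfold ff; linarith

lemma ff_neg_le_sq {u : ℝ} (hu : 0 ≤ u) : ff (-u) ≤ u ^ 2 / 2 := by
  have h1 := Real.quadratic_le_exp_of_nonneg hu
  have e3 : Real.exp u * Real.exp (-u) = 1 := by rw [← Real.exp_add]; simp
  have h0 : 0 < Real.exp (-u) := Real.exp_pos _
  have h2 : (1 + u + u^2/2) * Real.exp (-u) ≤ 1 := by nlinarith
  have h3 : 0 < 1 - u + u^2/2 := by nlinarith [sq_nonneg (u-1)]
  have h4 : (1 - u + u^2/2) * ((1 + u + u^2/2) * Real.exp (-u)) ≤ (1 - u + u^2/2) * 1 :=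
    mul_le_mul_of_nonneg_left h2 h3.le
  have h5 : Real.exp (-u) ≤ (1 + u^4/4) * Real.exp (-u) := by
    have : 0 ≤ u^4/4 := by positivity
    nlinarith
  unfold ff
  nlinarith

lemma RR_neg_le {l s : ℝ} (hl : 0 < l) (hs : 0 ≤ s) : RR l (-s) ≤ RR l s := by
  unfold RR
  rw [neg_mul]
  exact div_le_div_of_nonneg_right (ff_neg_le (by positivity)) (ff_nonneg _)

lemma RR_neg_le_sq {l s : ℝ} (hl : 0 < l) (hs : 0 ≤ s) : RR l (-s) ≤ s ^ 2 * (l ^ 2 / (2 * ff l)) := by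
  unfold RR
  rw [neg_mul, div_le_iff₀ (ff_pos hl.ne')]
  have := ff_neg_le_sq (u := s * l) (by positivity)
  have e : s ^ 2 * (l ^ 2 / (2 * ff l)) * ff l = (s * l) ^ 2 / 2 := by
    have := (ff_pos hl.ne').ne'
    field_simp
  rw [e]; exact this

lemma RR_le_exp {l t : ℝ} (hl : 0 < l) (ht0 : 0 ≤ t) (ht1 : t ≤ 1) : RR l t ≤ Real.exp (-((1 - t) * l)) := by
  unfold RR
  rw [div_le_iff₀ (ff_pos hl.ne')]
  have h1 := Real.add_one_le_exp ((1 - t) * l)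
  have e3 : Real.exp ((1 - t) * l) * Real.exp (-((1 - t) * l)) = 1 := by rw [← Real.exp_add]; simp
  have h0 : 0 < Real.exp (-((1 - t) * l)) := Real.exp_pos _
  have e4 : Real.exp (t * l) = Real.exp l * Real.exp (-((1 - t) * l)) := by rw [← Real.exp_add]; ring_nf
  unfold ff
  rw [e4]
  set E := Real.exp (-((1 - t) * l))
  have h2 : ((1 - t) * l + 1) * E ≤ 1 := by nlinarith
  have h3 : 0 ≤ t * l := by positivity
  have h4 : 0 ≤ (1 - t) * l := mul_nonneg (by linarith) hl.le
  have h5 : (1 + l) * E ≤ (1 + t * l) * (((1 - t) * l + 1) * E) := by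
    have : 0 ≤ (t * l) * ((1 - t) * l) * E := by positivity
    nlinarith
  nlinarith
end XS

namespace XS
open Real

lemma exp359 : 36.2335 ≤ Real.exp 3.59 := by
  have h := Real.sum_le_exp_of_nonneg (x := 3.59) (by norm_num) 18
  refine le_trans ?_ h
  norm_num [Finset.sum_range_succ, Nat.factorial]

lemma exp36 : Real.exp 3.6 ≤ 36.6 := by
  have h := Real.exp_bound' (x := 0.9) (by norm_num) (by norm_num) (n := 10) (by norm_num)
  norm_num [Finset.sum_range_succ, Nat.factorial] at h
  have e : Real.exp 3.6 = Real.exp 0.9 ^ 4 := by rw [← Real.exp_nat_mul]; norm_num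
  rw [e]
  have h2 : Real.exp 0.9 ≤ 2.459604 := by norm_num; linarith
  calc Real.exp 0.9 ^ 4 ≤ 2.459604 ^ 4 := by gcongr
    _ ≤ 36.6 := by norm_num

lemma ff359 : 31.6435 ≤ ff 3.59 := by have := exp359; unfold ff; linarith
lemma ff36 : ff 3.6 ≤ 32 := by have := exp36; unfold ff; linarith

lemma gg_alt {l : ℝ} (hl : 0 < l) : gg l = l + l ^ 2 / ff l := by
  have := (ff_pos hl.ne').ne'
  unfold gg; field_simp; unfold ff; ring

lemma lamstar : ∃ L, 3.59 ≤ L ∧ L ≤ 3.6 ∧ gg L = 4 := by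
  have h1 : gg 3.59 ≤ 4 := by
    rw [gg_alt (by norm_num)]
    have : (3.59:ℝ)^2 / ff 3.59 ≤ 0.41 := by
      rw [div_le_iff₀ (ff_pos (by norm_num))]; have := ff359; norm_num at *; linarith
    linarith
  have h2 : 4 ≤ gg 3.6 := by
    rw [gg_alt (by norm_num)]
    have : 0.4 ≤ (3.6:ℝ)^2 / ff 3.6 := by
      rw [le_div_iff₀ (ff_pos (by norm_num))]; have := ff36; norm_num at *; linarith
    linarith
  have hc : ContinuousOn gg (Set.Icc 3.59 3.6) := fun x hx =>
    (gg_contAt (by linarith [hx.1])).continuousWithinAt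
  obtain ⟨l, hl, he⟩ := intermediate_value_Icc (by norm_num) hc ⟨h1, h2⟩
  exact ⟨l, hl.1, hl.2, he⟩

/-- K t = log 2 - h((1-t)/2) -/
lemma hasSum_K {t : ℝ} (ht0 : 0 ≤ t) (ht1 : t < 1) :
    HasSum (fun i : ℕ => t ^ (2 * i + 2) / ((2 * i + 1) * (2 * i + 2)))
      (Real.log 2 - binEntropy ((1 - t) / 2)) := by
  have habs : |t| < 1 := by rw [abs_of_nonneg ht0]; exact ht1
  have h1 := Real.hasSum_log_sub_log_of_abs_lt_one habs
  have h2 := Real.hasSum_pow_div_log_of_abs_lt_one (x := t ^ 2) (by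
    rw [abs_of_nonneg (by positivity)]; nlinarith)
  have h3 := ((h1.mul_left t).sub h2).mul_left (1 / 2)
  refine hs_congr h3 (fun i => ?_) ?_
  · have : (2 * (i:ℝ) + 1) ≠ 0 := by positivity
    have : ((i:ℝ) + 1) ≠ 0 := by positivity
    have : (2 * (i:ℝ) + 2) ≠ 0 := by positivity
    have e : t ^ (2 * i + 2) = t ^ (2 * i) * t ^ 2 := by ring
    rw [e, ← pow_mul, show 2 * (i + 1) = 2 * i + 2 from by ring, e, pow_succ]
    field_simp
    ring
  · rw [binEntropy_eq_negMulLog_add_negMulLog_one_sub, Real.negMulLog, Real.negMulLog]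
    have e1 : Real.log (1 - t ^ 2) = Real.log (1 + t) + Real.log (1 - t) := by
      rw [← Real.log_mul (by linarith) (by linarith)]; ring_nf
    have e2 : Real.log (1 - (1 - t) / 2) = Real.log (1 + t) - Real.log 2 := by
      rw [← Real.log_div (by linarith) (by norm_num)]; ring_nf
    have e3 : Real.log ((1 - t) / 2) = Real.log (1 - t) - Real.log 2 :=
      Real.log_div (by linarith) (by norm_num)
    rw [e1, e2, e3]; ring

lemma h_upper {t : ℝ} (ht0 : 0 ≤ t) (ht1 : t < 1) :
    t ^ 2 / 2 + t ^ 4 / 12 + t ^ 6 / 30 + t ^ 8 / 56 ≤ Real.log 2 - binEntropy ((1 - t) / 2) := by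
  have := sum_le_hasSum (Finset.range 4) (fun i _ => by positivity) (hasSum_K ht0 ht1)
  refine le_trans (le_of_eq ?_) this
  norm_num [Finset.sum_range_succ]

lemma h_lower {t : ℝ} (ht0 : 0 ≤ t) (ht1 : t ≤ 0.8) :
    Real.log 2 - binEntropy ((1 - t) / 2) ≤ t ^ 2 / 2 + t ^ 4 / 12 + t ^ 6 / 30 + 2.778 * (t ^ 8 / 56) := by
  have hK := (hasSum_nat_add_iff' 3).mpr (hasSum_K ht0 (by linarith))
  have hg := (hasSum_geometric_of_lt_one (r := t ^ 2) (by positivity) (by nlinarith)).mul_left (t ^ 8 / 56)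
  have := hasSum_le (fun i => ?_) hK hg
  · norm_num [Finset.sum_range_succ] at this
    have h2 : (1 - t ^ 2)⁻¹ ≤ 2.778 := by
      rw [inv_le_comm₀ (by nlinarith) (by norm_num)]; norm_num; nlinarith
    have h3 := mul_le_mul_of_nonneg_left h2 (show 0 ≤ t ^ 8 / 56 by positivity)
    linarith
  · rw [← pow_mul, div_mul_eq_mul_div, ← pow_add, show 2 * (i + 3) + 2 = 8 + 2 * i by ring]
    apply div_le_div_of_nonneg_left (by positivity) (by norm_num)
    push_cast
    have : (0:ℝ) ≤ i := by positivity
    nlinarith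

lemma RR359 {t : ℝ} (ht0 : 0 ≤ t) (ht1 : t ≤ 1) : RR 3.59 t ≤ 0.2037 * t ^ 2 + 0.2437 * t ^ 3 + 0.2188 * t ^ 4
    + 0.1571 * t ^ 5 + 0.094 * t ^ 6 + 0.0482 * t ^ 7 + 0.0345 * t ^ 8 := by
  have h1 := ((hasSum_ff 3.59).mul_left (t ^ 8)).sub (hasSum_ff_mul 3.59 t)
  have h2 := sum_le_hasSum (Finset.range 6) (fun i hi => by
    simp only [Finset.mem_range, not_lt] at hi
    rw [← sub_mul]
    apply mul_nonneg _ (by positivity)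
    rw [sub_nonneg]
    exact pow_le_pow_of_le_one ht0 ht1 (by omega)) h1
  unfold RR
  rw [div_le_iff₀ (ff_pos (by norm_num))]
  have hf := ff359
  norm_num [Finset.sum_range_succ, Nat.factorial] at h2 hf ⊢
  have m : ∀ i j : ℕ, i ≤ j → t ^ j ≤ t ^ i := fun i j h => pow_le_pow_of_le_one ht0 ht1 h
  set F := ff (359 / 100)
  have q : ∀ i : ℕ, i ≤ 8 → 0 ≤ (F - 63287 / 2000) * (t ^ i - t ^ 8) := fun i h =>
    mul_nonneg (by linarith) (by linarith [m i 8 h])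
  have q2 := q 2 (by norm_num)
  have q3 := q 3 (by norm_num)
  have q4 := q 4 (by norm_num)
  have q5 := q 5 (by norm_num)
  have q6 := q 6 (by norm_num)
  have q7 := q 7 (by norm_num)
  have m2 := m 2 8 (by norm_num)
  have m3 := m 3 8 (by norm_num)
  have m4 := m 4 8 (by norm_num)
  have m5 := m 5 8 (by norm_num)
  have m6 := m 6 8 (by norm_num)
  have m7 := m 7 8 (by norm_num)
  linarith

lemma RR36 {t : ℝ} (ht0 : 0 ≤ t) (ht1 : t ≤ 1) : 0.202 * t ^ 2 + 0.243 * t ^ 3 + 0.218 * t ^ 4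
    + 0.157 * t ^ 5 + 0.094 * t ^ 6 + 0.048 * t ^ 7 ≤ RR 3.6 t := by
  have h2 := sum_le_hasSum (Finset.range 6) (fun i hi => by positivity) (hasSum_ff_mul 3.6 t)
  unfold RR
  rw [le_div_iff₀ (ff_pos (by norm_num))]
  have hf := ff36
  norm_num [Finset.sum_range_succ, Nat.factorial] at h2 hf ⊢
  refine le_trans ?_ h2
  set F := ff (18/5)
  have : (101 / 500 * t ^ 2 + 243 / 1000 * t ^ 3 + 109 / 500 * t ^ 4 + 157 / 1000 * t ^ 5 + 47 / 500 * t ^ 6 +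
        6 / 125 * t ^ 7) * F ≤ (101 / 500 * t ^ 2 + 243 / 1000 * t ^ 3 + 109 / 500 * t ^ 4 + 157 / 1000 * t ^ 5 + 47 / 500 * t ^ 6 +
        6 / 125 * t ^ 7) * 32 := by gcongr
  refine this.trans ?_
  have p2 : 0 ≤ t ^ 2 := by positivity
  have p3 : 0 ≤ t ^ 3 := by positivity
  have p4 : 0 ≤ t ^ 4 := by positivity
  have p5 : 0 ≤ t ^ 5 := by positivity
  have p6 : 0 ≤ t ^ 6 := by positivity
  have p7 : 0 ≤ t ^ 7 := by positivity
  linarith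

lemma poly1 {t : ℝ} (ht0 : 0 < t) (ht1 : t ≤ 0.8) : 0.2037 * t ^ 2 + 0.2437 * t ^ 3 + 0.2188 * t ^ 4
    + 0.1571 * t ^ 5 + 0.094 * t ^ 6 + 0.0482 * t ^ 7 + 0.0345 * t ^ 8 <
    t ^ 2 / 2 + 5 / 24 * t ^ 4 + 23 / 240 * t ^ 6 + 0.051 * t ^ 8 := by
  have hb : ∀ i j : ℕ, 0 ≤ t ^ i * (0.8 - t) ^ j := fun i j => mul_nonneg (by positivity) (pow_nonneg (by linarith) _)
  have h0 := hb 0 6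
  have h1 := hb 1 5
  have h2 := hb 2 4
  have h3 := hb 3 3
  have h4 := hb 4 2
  have h5 := hb 5 1
  have h6 : 0 < t ^ 6 := by positivity
  have : 0 < (0.5 - 0.2037) - 0.2437 * t + (5/24 - 0.2188) * t^2 - 0.1571 * t^3 + (23/240 - 0.094) * t^4 - 0.0482 * t^5
    + (0.051 - 0.0345) * t^6 := by
    norm_num at *
    linarith
  have h7 := mul_pos (show 0 < t^2 by positivity) this
  linarith

lemma poly2 {t : ℝ} (ht0 : 0 < t) (ht1 : t ≤ 0.8) : 0 ≤ (1 + (0.202 * t ^ 2 + 0.243 * t ^ 3 + 0.218 * t ^ 4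
    + 0.157 * t ^ 5 + 0.094 * t ^ 6 + 0.048 * t ^ 7)) * (0.6931 - (t ^ 2 / 2 + t ^ 4 / 12 + t ^ 6 / 30 + 2.778 * (t ^ 8 / 56)))
    - 2 * t ^ 2 + 2 * (0.202 * t ^ 2 + 0.243 * t ^ 3 + 0.218 * t ^ 4
    + 0.157 * t ^ 5 + 0.094 * t ^ 6 + 0.048 * t ^ 7) := by
  have hb : ∀ i j : ℕ, 0 ≤ t ^ i * (0.8 - t) ^ j := fun i j => mul_nonneg (by positivity) (pow_nonneg (by linarith) _)
  have h0 := hb 0 15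
  have h1 := hb 1 14
  have h2 := hb 2 13
  have h3 := hb 3 12
  have h4 := hb 4 11
  have h5 := hb 5 10
  have h6 := hb 6 9
  have h7 := hb 7 8
  have h8 := hb 8 7
  have h9 := hb 9 6
  have h10 := hb 10 5
  have h11 := hb 11 4
  have h12 := hb 12 3
  have h13 := hb 13 2
  have h14 := hb 14 1
  have h15 := hb 15 0
  norm_num at *
  linarith

lemma exp_lb {S : ℝ} (hS : 0 ≤ S) : S + S^2/2 + S^3/6 + S^4/24 ≤ Real.exp S - 1 := by
  have h := Real.sum_le_exp_of_nonneg (x := S) hS 5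
  norm_num [Finset.sum_range_succ, Nat.factorial] at h
  linarith

lemma M4 {t : ℝ} (ht0 : 0 < t) (ht1 : t ≤ 0.8) : Real.log (1 + RR 3.59 t) < Real.log 2 - binEntropy ((1 - t) / 2) := by
  have h1 := RR359 ht0.le (by linarith)
  have h2 := h_upper ht0.le (by linarith)
  set S := t ^ 2 / 2 + t ^ 4 / 12 + t ^ 6 / 30 + t ^ 8 / 56 with hS
  have h3 := poly1 ht0 ht1
  have hS0 : 0 ≤ S := by positivity
  have h4 : t ^ 2 / 2 + 5 / 24 * t ^ 4 + 23 / 240 * t ^ 6 + 0.051 * t ^ 8 ≤ S + S^2/2 + S^3/6 + S^4/24 := by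
    have a1 : t^4/4 + t^6/12 + (1/144+1/30)*t^8 ≤ S^2 := by
      rw [hS]
      have : 0 ≤ t^10 * (1/56 + 1/180) + t^12 * (1/900 + 1/(6*56)) + t^14/(15*56) + t^16/56^2 := by positivity
      linarith
    have a2 : t^6/8 + t^8/16 ≤ S^3 := by
      have : (t^2/2 + t^4/12)^3 ≤ S^3 := by
        apply pow_le_pow_left₀ (by positivity)
        rw [hS]; have : 0 ≤ t^6/30 + t^8/56 := by positivity
        linarith
      refine le_trans ?_ this
      have : 0 ≤ t^10/96 + t^12/12^3 := by positivity
      linarith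
    have a3 : t^8/16 ≤ S^4 := by
      have : (t^2/2)^4 ≤ S^4 := by
        apply pow_le_pow_left₀ (by positivity)
        rw [hS]; have : 0 ≤ t^4/12 + t^6/30 + t^8/56 := by positivity
        linarith
      refine le_trans (le_of_eq (by ring)) this
    have : 0 ≤ t^8 := by positivity
    linarith
  have h5 := exp_lb hS0
  have h6 : 1 + RR 3.59 t < Real.exp S := by linarith
  have h7 : 0 < 1 + RR 3.59 t := by have := RR_nonneg 3.59 t; linarith
  have := Real.log_lt_log h7 h6
  rw [Real.log_exp] at this
  linarith
end XS

namespace XS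
open Real

noncomputable def DD (α a : ℝ) : ℝ := - binEntropy α - α * Real.log a - (1 - α) * Real.log (1 - a)

lemma DD_self {α : ℝ} : DD α α = 0 := by
  unfold DD; rw [binEntropy_eq_negMulLog_add_negMulLog_one_sub, negMulLog, negMulLog]; ring

lemma nml_le {p q : ℝ} (hp : 0 ≤ p) (hq : 0 < q) : negMulLog p ≤ - p * Real.log q + (q - p) := by
  rcases hp.eq_or_lt with h | h
  · subst h; simp; exact hq.le
  · unfold negMulLog
    have h1 := Real.log_le_sub_one_of_pos (div_pos hq h)
    rw [Real.log_div hq.ne' h.ne'] at h1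
    have h2 := mul_le_mul_of_nonneg_left h1 h.le
    have e : p * (q / p - 1) = q - p := by field_simp
    rw [e] at h2
    linarith

lemma h_gibbs {p q : ℝ} (hp : 0 ≤ p) (hp1 : p ≤ 1) (hq : 0 < q) (hq1 : q < 1) :
    binEntropy p ≤ - p * Real.log q - (1 - p) * Real.log (1 - q) := by
  rw [binEntropy_eq_negMulLog_add_negMulLog_one_sub]
  have h1 := nml_le hp hq
  have h2 := nml_le (p := 1 - p) (q := 1 - q) (by linarith) (by linarith)
  linarith

lemma log10 : 2.3025 ≤ Real.log 10 ∧ Real.log 10 ≤ 2.3026 := by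
  rw [Real.log_ten_eq]
  have := Real.log_two_gt_d9
  have := Real.log_two_lt_d9
  have := Real.log_five_gt_d9
  have := Real.log_five_lt_d9
  constructor <;> linarith

lemma logp9 : -0.1054 ≤ Real.log 0.9 := by
  have e : (0.9:ℝ) = 3 ^ 2 / 10 := by norm_num
  rw [e, Real.log_div (by norm_num) (by norm_num), Real.log_pow]
  have := log10.2
  have := Real.log_three_gt_d9
  push_cast; linarith

lemma logp1 : Real.log 0.1 = - Real.log 10 := by
  rw [← Real.log_inv]; norm_num

lemma h_tenth {p : ℝ} (hp : 0 ≤ p) (hp1 : p ≤ 1) : binEntropy p ≤ 2.3026 * p + 0.1054 * (1 - p) := by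
  have h := h_gibbs (q := 0.1) hp hp1 (by norm_num) (by norm_num)
  rw [logp1, show (1:ℝ) - 0.1 = 0.9 by norm_num] at h
  have := logp9
  have := log10.2
  nlinarith

lemma caseI_pos {l c t : ℝ} (hl : 0 < l) (hc : c < 1) (hc4 : c ≤ gg l / 4) (ht0 : 0 < t) (ht1 : t ≤ 0.8) :
    c * binEntropy ((1 - t) / 2) + Real.log ((1 + RR l t) / 2) < 0 := by
  obtain ⟨L, hL1, hL2, hL⟩ := lamstar
  have hR0 := RR_nonneg l t
  have hRs0 := RR_nonneg L t
  rw [Real.log_div (by positivity) (by norm_num)]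
  set h := binEntropy ((1 - t) / 2) with hh
  have hh0 : 0 ≤ h := binEntropy_nonneg (by linarith) (by linarith)
  have m4 := M4 ht0 ht1
  have m4' : Real.log (1 + RR L t) ≤ Real.log (1 + RR 3.59 t) :=
    Real.log_le_log (by positivity) (by linarith [RR_anti ht0.le (by linarith) (by norm_num : (0:ℝ) < 3.59) hL1])
  rw [← hh] at m4
  rcases le_total L l with hLl | hLl
  · have h1 := RR_anti ht0.le (by linarith) (by linarith) hLl (t := t)
    have h2 : Real.log (1 + RR l t) ≤ Real.log (1 + RR L t) := Real.log_le_log (by positivity) (by linarith)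
    nlinarith
  · have h1 := RR_chord ht0.le (by linarith : t ≤ 1) hl hLl (by linarith)
    have hgl := gg_mono hl hLl
    rw [hL] at h1 hgl
    have h3 := RR36 ht0.le (by linarith : t ≤ 1)
    have h3' := RR_anti ht0.le (by linarith : t ≤ 1) (by linarith) hL2
    have h4 := h_lower ht0.le ht1
    rw [← hh] at h4
    have hlog2 := Real.log_two_gt_d9
    have h5 := poly2 ht0 ht1
    set P := 0.202 * t ^ 2 + 0.243 * t ^ 3 + 0.218 * t ^ 4
    + 0.157 * t ^ 5 + 0.094 * t ^ 6 + 0.048 * t ^ 7 with hP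
    have hP0 : 0 ≤ P := by positivity
    have h6 : 2 * (t ^ 2 - RR L t) ≤ (1 + RR L t) * h := by
      have a : (1 + P) * (0.6931 - (t ^ 2 / 2 + t ^ 4 / 12 + t ^ 6 / 30 + 2.778 * (t ^ 8 / 56))) ≤ (1 + P) * h := by
        apply mul_le_mul_of_nonneg_left _ (by linarith)
        linarith
      have b : (1 + P) * h ≤ (1 + RR L t) * h := mul_le_mul_of_nonneg_right (by linarith) hh0
      linarith
    set A := RR L t
    have h7 : Real.log (1 + RR l t) ≤ Real.log (1 + A) + (RR l t - A) / (1 + A) := by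
      have := Real.log_le_sub_one_of_pos (show 0 < (1 + RR l t) / (1 + A) by positivity)
      rw [Real.log_div (by positivity) (by positivity)] at this
      have e : (1 + RR l t) / (1 + A) - 1 = (RR l t - A) / (1 + A) := by field_simp; ring
      linarith
    have h8 : (RR l t - A) / (1 + A) ≤ (4 - gg l) * (h / 4) := by
      rw [div_le_iff₀ (by positivity)]
      have : RR l t - A ≤ (4 - gg l) * ((t ^ 2 - A) / 2) := by linarith
      have : (4 - gg l) * ((t ^ 2 - A) / 2) ≤ (4 - gg l) * ((1 + A) * h / 4) :=
        mul_le_mul_of_nonneg_left (by linarith) (by linarith)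
      linarith
    have h9 : c * h ≤ gg l / 4 * h := mul_le_mul_of_nonneg_right hc4 hh0
    linarith

lemma caseI {l c α : ℝ} (hl : 0 < l) (hc : c < 1) (hc4 : c ≤ gg l / 4) (h1 : 0.1 ≤ α) (h2 : α ≤ 0.9) :
    c * binEntropy α + Real.log ((1 + RR l (1 - 2 * α)) / 2) < 0 := by
  rcases lt_trichotomy α 0.5 with h | h | h
  · have := caseI_pos hl hc hc4 (t := 1 - 2 * α) (by linarith) (by linarith)
    rwa [show (1 - (1 - 2 * α)) / 2 = α by ring] at this
  · have e : RR l (1 - 2 * α) = 0 := by rw [h]; norm_num [RR, ff]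
    rw [e, h, show (0.5:ℝ) = 2⁻¹ by norm_num, binEntropy_two_inv, show ((1:ℝ)+0)/2 = 2⁻¹ by norm_num, Real.log_inv]
    have := Real.log_two_gt_d9
    nlinarith
  · have := caseI_pos hl hc hc4 (t := 2 * α - 1) (by linarith) (by linarith)
    rw [show (1 - (2 * α - 1)) / 2 = 1 - α by ring, binEntropy_one_sub] at this
    have h3 := RR_neg_le hl (s := 2 * α - 1) (by linarith)
    rw [show -(2 * α - 1) = 1 - 2 * α by ring] at h3
    have h4 : Real.log ((1 + RR l (1 - 2 * α)) / 2) ≤ Real.log ((1 + RR l (2 * α - 1)) / 2) := by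
      apply Real.log_le_log
      · have := RR_nonneg l (1 - 2 * α); positivity
      · linarith
    linarith

lemma caseII {l c k α : ℝ} (hl : 0 < l) (hk : 10 ≤ k) (hck : c = gg l / k) (hc : c < 1) (h1 : 1 / k ≤ α) (h2 : α ≤ 0.1) :
    c * binEntropy α + Real.log ((1 + RR l (1 - 2 * α)) / 2) < 0 := by
  have hg2 := two_lt_gg hl
  have hk0 : 0 < k := by linarith
  have hα : 0 < α := lt_of_lt_of_le (by positivity) h1
  have hc0 : 0 ≤ c := by rw [hck]; positivity
  have hR0 := RR_nonneg l (1 - 2 * α)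
  have hlog : Real.log ((1 + RR l (1 - 2 * α)) / 2) ≤ - ((1 - RR l (1 - 2 * α)) / 2) := by
    have := Real.log_le_sub_one_of_pos (show 0 < (1 + RR l (1 - 2 * α)) / 2 by positivity)
    linarith
  have hh : c * binEntropy α ≤ gg l * α * 0.3303 := by
    have a1 : binEntropy α ≤ α * (Real.log k + 1) := by
      rw [binEntropy_eq_negMulLog_add_negMulLog_one_sub]
      have b1 := nml_le (p := 1 - α) (q := 1) (by linarith) (by norm_num)
      have b2 : -Real.log k ≤ Real.log α := by
        rw [← Real.log_inv]; apply Real.log_le_log (by positivity); rw [← one_div]; exact h1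
      simp at b1
      unfold negMulLog at b1 ⊢
      nlinarith
    have a2 : Real.log k ≤ 2.3026 + (k / 10 - 1) := by
      have := Real.log_le_sub_one_of_pos (show 0 < k / 10 by positivity)
      rw [Real.log_div (by positivity) (by norm_num)] at this
      linarith [log10.2]
    have a3 : binEntropy α ≤ α * (2.3026 + k / 10) := by
      refine a1.trans (mul_le_mul_of_nonneg_left (by linarith) hα.le)
    calc c * binEntropy α ≤ c * (α * (2.3026 + k / 10)) := mul_le_mul_of_nonneg_left a3 hc0
      _ = gg l * α * (2.3026 / k + 1 / 10) := by rw [hck]; field_simp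
      _ ≤ gg l * α * 0.3303 := by
        apply mul_le_mul_of_nonneg_left _ (by positivity)
        have : 2.3026 / k ≤ 2.3026 / 10 := div_le_div_of_nonneg_left (by norm_num) (by norm_num) hk
        linarith
  rcases le_total (gg l) 4 with hg | hg
  · have h3 := RR_le_sq hl (t := 1 - 2 * α) (by linarith) (by linarith)
    have h4 : gg l * α * 0.3303 ≤ 4 * α * 0.3303 := by nlinarith
    nlinarith
  · have hl3 : 3.59 ≤ l := by
      by_contra hcon
      push Not at hcon
      obtain ⟨L, hL1, hL2, hL⟩ := lamstar
      have := gg_strictMono (show l ∈ Set.Ioi 0 from hl) (show L ∈ Set.Ioi (0:ℝ) from (by linarith : (0:ℝ) < L)) (by linarith)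
      linarith
    have hff : 7 * l ≤ ff l := by
      have h := Real.sum_le_exp_of_nonneg (x := l) hl.le 6
      norm_num [Finset.sum_range_succ, Nat.factorial] at h
      unfold ff
      have e1 : 3.59 * l ≤ l ^ 2 := by nlinarith
      have e2 : 3.59 * l ^ 2 ≤ l ^ 3 := by nlinarith [sq_nonneg l]
      have e3 : 3.59 * l ^ 3 ≤ l ^ 4 := by nlinarith [pow_pos hl 3]
      have e4 : 3.59 * l ^ 4 ≤ l ^ 5 := by nlinarith [pow_pos hl 4]
      linarith
    have hgl : gg l ≤ 8 / 7 * l := by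
      rw [gg_alt hl]
      have : l ^ 2 / ff l ≤ l / 7 := by
        rw [div_le_div_iff₀ (ff_pos hl.ne') (by norm_num)]; nlinarith
      linarith
    have hRe := RR_le_exp hl (t := 1 - 2 * α) (by linarith) (by linarith)
    set z := 2 * α * l with hz
    rw [show -((1 - (1 - 2 * α)) * l) = - z by rw [hz]; ring, Real.exp_neg] at hRe
    have hz0 : 0 < z := by positivity
    have hq := Real.quadratic_le_exp_of_nonneg hz0.le
    have hRe2 : RR l (1 - 2 * α) ≤ (1 + z + z ^ 2 / 2)⁻¹ := hRe.trans (inv_anti₀ (by positivity) hq)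
    rcases le_total z 2 with hz2 | hz2
    · have h5 : gg l * α * 0.3303 ≤ 0.19 * z := by rw [hz]; nlinarith
      have h6 : (1 + z + z ^ 2 / 2)⁻¹ < 1 - 0.38 * z := by
        rw [inv_lt_iff_one_lt_mul₀ (by positivity)]
        nlinarith [mul_pos hz0 hz0, mul_nonneg hz0.le (sub_nonneg.2 hz2), mul_nonneg (mul_pos hz0 hz0).le (sub_nonneg.2 hz2)]
      linarith
    · have h6 : (1 + z + z ^ 2 / 2)⁻¹ ≤ 5⁻¹ := inv_anti₀ (by norm_num) (by nlinarith)
      have h7 := h_tenth hα.le (by linarith)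
      have h8 : 0 ≤ binEntropy α := binEntropy_nonneg hα.le (by linarith)
      have h9 : c * binEntropy α ≤ 1 * binEntropy α := mul_le_mul_of_nonneg_right hc.le h8
      norm_num at h6
      linarith
end XS

namespace XS
open Real

noncomputable def psi (c g l α a : ℝ) : ℝ :=
  c * binEntropy α + g * DD α a + Real.log ((1 + RR l (1 - 2 * a)) / 2)

lemma rho_lt {l : ℝ} (hl : 0 < l) : l ^ 2 / (2 * ff l) < 1 := by
  rw [div_lt_one (by have := ff_pos hl.ne'; positivity)]
  have h := Real.sum_le_exp_of_nonneg (x := l) hl.le 4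
  norm_num [Finset.sum_range_succ, Nat.factorial] at h
  have := pow_pos hl 3
  unfold ff; linarith

lemma caseIII0 {c l : ℝ} (hl : 0 < l) : ∃ a, 0 < a ∧ a < 1 ∧ psi c (gg l) l 1 a < 0 := by
  have hg2 := two_lt_gg hl
  set ρ := l ^ 2 / (2 * ff l) with hρ
  have hρ1 : ρ < 1 := rho_lt hl
  have hρ0 : 0 ≤ ρ := by have := ff_pos hl.ne'; positivity
  set b := min (1/2) ((1 - ρ) / (8 * gg l)) with hb
  have hb0 : 0 < b := lt_min (by norm_num) (div_pos (by linarith) (by linarith))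
  have hb1 : b ≤ 1/2 := min_le_left _ _
  have hb2 : b * (8 * gg l) ≤ 1 - ρ := by
    rw [← le_div_iff₀ (by linarith)]; exact min_le_right _ _
  refine ⟨1 - b, by linarith, by linarith, ?_⟩
  have hR := RR_neg_le_sq hl (s := 1 - 2 * b) (by linarith)
  rw [← hρ] at hR
  unfold psi DD
  simp only [binEntropy_one, sub_self, zero_mul, sub_zero, mul_zero, neg_zero, one_mul, zero_sub, zero_add]
  rw [show 1 - 2 * (1 - b) = -(1 - 2 * b) by ring]
  have h0 := RR_nonneg l (-(1 - 2 * b))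
  have h1 := Real.log_le_sub_one_of_pos (show 0 < (1 + RR l (-(1 - 2 * b))) / 2 by positivity)
  have h2 := Real.one_sub_inv_le_log_of_pos (show 0 < 1 - b by linarith)
  have h3 : (1 - 2 * b) ^ 2 * ρ ≤ ρ := by
    have : (1 - 2 * b) ^ 2 ≤ 1 := by nlinarith
    nlinarith
  have h4 : (1 - b)⁻¹ ≤ 1 + 2 * b := by
    rw [inv_le_iff_one_le_mul₀ (by linarith)]; nlinarith
  have h5 : gg l * (-Real.log (1 - b)) ≤ gg l * (2 * b) := mul_le_mul_of_nonneg_left (by linarith) (by linarith)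
  nlinarith

lemma caseIIIa {c l β : ℝ} (hl : 2 ≤ l) (hc : c < 1) (hβ : 0 < β) (hβ1 : β ≤ 0.1) :
    psi c (gg l) l (1 - β) (1 - β) < 0 := by
  have hl0 : 0 < l := by linarith
  unfold psi
  rw [DD_self, binEntropy_one_sub, show 1 - 2 * (1 - β) = -(1 - 2 * β) by ring]
  have hR := RR_neg_le_sq hl0 (s := 1 - 2 * β) (by linarith)
  have hρ : l ^ 2 / (2 * ff l) ≤ 1 / 2 := by
    rw [div_le_div_iff₀ (by have := ff_pos hl0.ne'; positivity) (by norm_num)]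
    have h := Real.sum_le_exp_of_nonneg (x := l) hl0.le 5
    norm_num [Finset.sum_range_succ, Nat.factorial] at h
    have : 2 * l ^ 2 ≤ l ^ 3 := by nlinarith [sq_nonneg l]
    have : 2 * l ^ 3 ≤ l ^ 4 := by nlinarith [pow_pos hl0 3]
    unfold ff; linarith
  have h0 := RR_nonneg l (-(1 - 2 * β))
  have h1 := Real.log_le_sub_one_of_pos (show 0 < (1 + RR l (-(1 - 2 * β))) / 2 by positivity)
  have h2 : (1 - 2 * β) ^ 2 * (l ^ 2 / (2 * ff l)) ≤ (1 - 2 * β) ^ 2 * (1 / 2) :=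
    mul_le_mul_of_nonneg_left hρ (sq_nonneg _)
  have h7 := h_tenth hβ.le (by linarith)
  have h8 : 0 ≤ binEntropy β := binEntropy_nonneg hβ.le (by linarith)
  have h9 : c * binEntropy β ≤ 1 * binEntropy β := mul_le_mul_of_nonneg_right hc.le h8
  nlinarith

lemma Pr_bounds {l : ℝ} (hl : 0 < l) (hl2 : l ≤ 2) :
    1 - l ^ 2 / (2 * ff l) ≤ gg l - 2 ∧ gg l - 2 ≤ 1.7 * (1 - l ^ 2 / (2 * ff l)) ∧ 1 - l ^ 2 / (2 * ff l) ≤ 0.55 := by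
  have hf := ff_pos hl.ne'
  have hexp2 : Real.exp 2 = Real.exp 1 ^ 2 := by rw [← Real.exp_nat_mul]; norm_num
  have e1 := Real.exp_one_gt_d9
  have e2 := Real.exp_one_lt_d9
  have hP : ∀ x : ℝ, HasSum (fun i : ℕ => (if i = 0 then 0 else 1) * (x ^ (i + 2) / ((i + 2).factorial : ℝ)))
      (ff x - x ^ 2 / 2) := by
    intro x
    refine hs_congr ((hasSum_ff x).sub (hasSum_ite_eq 0 (x ^ 2 / 2))) (fun i => ?_) rfl
    rcases Nat.eq_zero_or_pos i with h | h
    · subst h; norm_num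
    · simp [h.ne']
  have hG : ∀ x : ℝ, HasSum (fun i : ℕ => (i : ℝ) * (x ^ (i + 2) / ((i + 2).factorial : ℝ)))
      (x * (Real.exp x - 1) - 2 * ff x) := by
    intro x
    exact hs_congr ((hasSum_gg x).sub ((hasSum_ff x).mul_left 2)) (fun i => by ring) rfl
  have hgf : gg l * ff l = l * (Real.exp l - 1) := by unfold gg; rw [div_mul_cancel₀ _ hf.ne']
  have hPf : (1 - l ^ 2 / (2 * ff l)) * ff l = ff l - l ^ 2 / 2 := by field_simp
  refine ⟨?_, ?_, ?_⟩
  · have := hasSum_le (fun i => ?_) (hP l) (hG l)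
    · refine le_of_mul_le_mul_right ?_ hf
      rw [hPf, sub_mul, hgf]; exact this
    · apply mul_le_mul_of_nonneg_right _ (by positivity)
      split_ifs with h
      · simp
      · exact_mod_cast Nat.one_le_iff_ne_zero.mpr h
  · have hs : ∀ x : ℝ, HasSum (fun i : ℕ => (1.7 * (if i = 0 then 0 else 1) - (i : ℝ)) * (x ^ (i + 2) / ((i + 2).factorial : ℝ)))
        (1.7 * (ff x - x ^ 2 / 2) - (x * (Real.exp x - 1) - 2 * ff x)) := by
      intro x
      exact hs_congr (((hP x).mul_left 1.7).sub (hG x)) (fun i => by ring) rfl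
    have := sign_lemma (fun i : ℕ => (1.7 * (if i = 0 then 0 else 1) - (i : ℝ))) (by
      intro i hi j hij
      have hij' : (i : ℝ) ≤ j := by exact_mod_cast hij
      have hi0 : i ≠ 0 := by rintro rfl; simp at hi
      have hj0 : j ≠ 0 := by omega
      simp only [hi0, hj0, if_false] at hi ⊢
      linarith) hl hl2 (hs 2) (hs l) (by
        unfold ff; rw [hexp2]; nlinarith)
    refine le_of_mul_le_mul_right ?_ hf
    rw [mul_assoc, hPf, sub_mul, hgf]; linarith
  · have h := RR_le_sq (l := 2) (t := l / 2) (by norm_num) (by linarith) (by linarith)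
    unfold RR at h
    rw [div_le_iff₀ (ff_pos (by norm_num)), div_mul_cancel₀ _ (by norm_num)] at h
    have h3 : ff 2 ≤ 4.39 := by unfold ff; rw [hexp2]; nlinarith
    have h4 : ff l ≤ (l / 2) ^ 2 * 4.39 := h.trans (mul_le_mul_of_nonneg_left h3 (sq_nonneg _))
    have : 0.45 ≤ l ^ 2 / (2 * ff l) := by
      rw [le_div_iff₀ (by positivity)]; nlinarith
    linarith

set_option maxHeartbeats 1000000 in
lemma caseIIIb {c l β : ℝ} (hl : 0 < l) (hl2 : l ≤ 2) (hc : c ≤ gg l / 4) (hβ : 0 < β) (hβ1 : β ≤ 0.1) :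
    ∃ a, 0 < a ∧ a < 1 ∧ psi c (gg l) l (1 - β) a < 0 := by
  obtain ⟨p1, p2, p3⟩ := Pr_bounds hl hl2
  set ρ := l ^ 2 / (2 * ff l) with hρ
  have hρ0 : 0 ≤ ρ := by have := ff_pos hl.ne'; positivity
  have hρ1 : ρ < 1 := rho_lt hl
  set x := √β with hx
  set y := √(1 - β) with hy
  have hx0 : 0 < x := Real.sqrt_pos.mpr hβ
  have hy0 : 0 < y := Real.sqrt_pos.mpr (by linarith)
  have hxx : x ^ 2 = β := Real.sq_sqrt hβ.le
  have hyy : y ^ 2 = 1 - β := Real.sq_sqrt (by linarith)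
  have hxy : x ≤ y := Real.sqrt_le_sqrt (by linarith)
  set r := x * y with hr
  have hr0 : 0 < r := by positivity
  have hr2 : r ^ 2 = β * (1 - β) := by rw [hr, mul_pow, hxx, hyy]
  have hr1 : 2 * r ≤ 1 := by nlinarith [sq_nonneg (x - y)]
  have hW : (x + y) ^ 2 = 1 + 2 * r := by rw [hr]; nlinarith
  have hW0 : 0 < x + y := by positivity
  have hlogW : Real.log (x + y) = Real.log (1 + 2 * r) / 2 := by
    rw [← hW, Real.log_pow]; push_cast; ring
  have hlogx : Real.log x = Real.log β / 2 := by rw [← hxx, Real.log_pow]; push_cast; ring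
  have hlogy : Real.log y = Real.log (1 - β) / 2 := by rw [← hyy, Real.log_pow]; push_cast; ring
  have hb : 1 - y / (x + y) = x / (x + y) := by field_simp; ring
  refine ⟨y / (x + y), by positivity, by rw [div_lt_one hW0]; linarith, ?_⟩
  set h := binEntropy β with hh
  have hhe : h = - β * Real.log β - (1 - β) * Real.log (1 - β) := by
    rw [hh, binEntropy_eq_negMulLog_add_negMulLog_one_sub, negMulLog, negMulLog]; ring
  have hD : DD (1 - β) (y / (x + y)) = - h / 2 + Real.log (1 + 2 * r) / 2 := by
    unfold DD
    rw [binEntropy_one_sub, ← hh, hb, Real.log_div hy0.ne' hW0.ne', Real.log_div hx0.ne' hW0.ne', hlogW, hlogx, hlogy]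
    linarith
  have hs : 1 - 2 * (y / (x + y)) = - ((y - x) / (x + y)) := by field_simp; ring
  unfold psi
  rw [hD, binEntropy_one_sub, ← hh, hs]
  have hR := RR_neg_le_sq hl (s := (y - x) / (x + y)) (div_nonneg (by linarith) hW0.le)
  rw [← hρ, div_pow, hW, show (y - x) ^ 2 = 1 - 2 * r by rw [hr]; nlinarith] at hR
  have hR0 := RR_nonneg l (-((y - x) / (x + y)))
  set R := RR l (-((y - x) / (x + y)))
  have hlogR : Real.log ((1 + R) / 2) ≤ - Real.log (1 + 2 * r) - (1 - ρ) * (1 - 2 * r) / 2 := by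
    have a1 : (1 + R) / 2 ≤ (1 - (1 - ρ) * (1 - 2 * r) / 2) / (1 + 2 * r) := by
      rw [le_div_iff₀ (by linarith)]
      have : (1 - 2 * r) / (1 + 2 * r) * ρ * (1 + 2 * r) = (1 - 2 * r) * ρ := by field_simp
      have h2r : 0 ≤ 1 + 2 * r := by linarith
      have := mul_le_mul_of_nonneg_right hR h2r
      linarith
    have a0 : 0 < 1 - (1 - ρ) * (1 - 2 * r) / 2 := by
      have : (1 - ρ) * (1 - 2 * r) ≤ 1 * 1 := mul_le_mul (by linarith) (by linarith) (by linarith) (by norm_num)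
      linarith
    have a2 := Real.log_le_log (by positivity) a1
    rw [Real.log_div a0.ne' (by linarith)] at a2
    have a3 := Real.log_le_sub_one_of_pos a0
    linarith
  have hlog1 : Real.log (1 + 2 * r) ≤ 2 * r := by
    have := Real.log_le_sub_one_of_pos (show 0 < 1 + 2 * r by linarith); linarith
  have hh0 : 3.2 * r ^ 2 ≤ h := by
    rw [hhe, hr2]
    have b1 : Real.log β ≤ - 2.3025 := by
      have := Real.log_le_log hβ hβ1
      rw [logp1] at this
      linarith [log10.1]
    have b2 := Real.log_le_sub_one_of_pos (show 0 < 1 - β by linarith)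
    nlinarith [mul_nonneg hβ.le (show 0 ≤ - 2.3025 - Real.log β by linarith), mul_nonneg (show 0 ≤ 1 - β by linarith) (show 0 ≤ - β - Real.log (1-β) by linarith)]
  have hhn : 0 ≤ h := le_trans (by positivity) hh0
  have c1 : c * h ≤ gg l / 4 * h := mul_le_mul_of_nonneg_right hc hhn
  set G := gg l
  set P := 1 - ρ with hP
  have hP0 : 0 < P := by rw [hP]; linarith
  have c2 : (G - 2) * Real.log (1 + 2 * r) ≤ (1.7 * P) * (2 * r) := by
    have : 0 ≤ Real.log (1 + 2 * r) := Real.log_nonneg (by linarith)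
    exact mul_le_mul p2 hlog1 this (by positivity)
  have c3 : (2 + P) / 4 * (3.2 * r ^ 2) ≤ G / 4 * h := mul_le_mul (by linarith) hh0 (by positivity) (by linarith)
  have c4 : P * (2.7 * r - 0.5 - 0.8 * r ^ 2) < 1.6 * r ^ 2 := by
    rcases le_total (2.7 * r - 0.5 - 0.8 * r ^ 2) 0 with hn | hn
    · have : 0 < r ^ 2 := by positivity
      nlinarith
    · have := mul_le_mul_of_nonneg_right p3 hn
      nlinarith [sq_nonneg (r - 0.364)]
  linarith

/-- The analytic key. -/
theorem psi_key {k : ℕ} (hk : 4 ≤ k) {l c : ℝ} (hl : 0 < l) (hck : gg l = k * c) (hc : c < 1) {α : ℝ}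
    (h1 : 1 / (max 10 k : ℝ) ≤ α) (h2 : α ≤ 1) : ∃ a, 0 < a ∧ a < 1 ∧ psi c (gg l) l α a < 0 := by
  have hk' : (4:ℝ) ≤ k := by exact_mod_cast hk
  have hg2 := two_lt_gg hl
  have hc0 : 0 < c := by
    by_contra hcon
    push Not at hcon
    nlinarith
  have hc4 : c ≤ gg l / 4 := by rw [hck]; nlinarith
  have hα0 : 0 < α := lt_of_lt_of_le (by positivity) h1
  rcases le_total α 0.9 with h9 | h9
  · refine ⟨α, hα0, by linarith, ?_⟩
    unfold psi
    rw [DD_self, mul_zero, add_zero]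
    rcases le_total 0.1 α with h01 | h01
    · exact caseI hl hc hc4 h01 h9
    · rcases le_total (10:ℝ) k with hk10 | hk10
      · rw [max_eq_right hk10] at h1
        exact caseII hl hk10 (by rw [hck]; field_simp) hc h1 h01
      · rw [max_eq_left hk10] at h1
        exact caseI hl hc hc4 (by norm_num at h1 ⊢; linarith) h9
  · rcases h2.eq_or_lt with h | h
    · subst h; exact caseIII0 hl
    · rcases le_total l 2 with hl2 | hl2
      · have := caseIIIb hl hl2 hc4 (β := 1 - α) (by linarith) (by linarith)
        simpa using this
      · have := caseIIIa hl2 hc (β := 1 - α) (by linarith) (by linarith)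
        refine ⟨α, hα0, h, ?_⟩
        simpa using this
end XS

namespace XS
open Real

lemma DD_cont (a : ℝ) : Continuous (fun α => DD α a) := by
  unfold DD; have := binEntropy_continuous; fun_prop

lemma psi_cont (c g l a : ℝ) : Continuous (fun α => psi c g l α a) := by
  unfold psi; have := binEntropy_continuous; have := DD_cont a; fun_prop

theorem psi_unif {k : ℕ} (hk : 4 ≤ k) {l c : ℝ} (hl : 0 < l) (hck : gg l = k * c) (hc : c < 1) :
    ∃ δ > 0, ∃ B, ∀ α ∈ Set.Icc (1 / (max 10 k : ℝ)) 1, ∃ a, 0 < a ∧ a < 1 ∧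
      psi c (gg l) l α a ≤ -δ ∧ |DD α a| ≤ B := by
  refine isCompact_Icc.induction_on (p := fun s => ∃ δ > 0, ∃ B, ∀ α ∈ s, ∃ a, 0 < a ∧ a < 1 ∧
      psi c (gg l) l α a ≤ -δ ∧ |DD α a| ≤ B) ?_ ?_ ?_ ?_
  · exact ⟨1, one_pos, 0, by simp⟩
  · rintro s t hst ⟨δ, hδ, B, h⟩
    exact ⟨δ, hδ, B, fun α hα => h α (hst hα)⟩
  · rintro s t ⟨δ, hδ, B, h⟩ ⟨δ', hδ', B', h'⟩
    refine ⟨min δ δ', lt_min hδ hδ', max B B', ?_⟩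
    rintro α (hα | hα)
    · obtain ⟨a, h1, h2, h3, h4⟩ := h α hα
      exact ⟨a, h1, h2, h3.trans (neg_le_neg (min_le_left _ _)), h4.trans (le_max_left _ _)⟩
    · obtain ⟨a, h1, h2, h3, h4⟩ := h' α hα
      exact ⟨a, h1, h2, h3.trans (neg_le_neg (min_le_right _ _)), h4.trans (le_max_right _ _)⟩
  · intro x hx
    obtain ⟨a, ha0, ha1, hp⟩ := psi_key hk hl hck hc hx.1 hx.2
    set δ := - psi c (gg l) l x a / 2 with hδ
    have hδ0 : 0 < δ := by rw [hδ]; linarith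
    have e1 : ∀ᶠ α in nhds x, psi c (gg l) l α a < -δ :=
      (psi_cont c (gg l) l a).continuousAt.eventually (gt_mem_nhds (by rw [hδ]; linarith))
    have e2 : ∀ᶠ α in nhds x, |DD α a| < |DD x a| + 1 :=
      (DD_cont a).abs.continuousAt.eventually (gt_mem_nhds (by linarith))
    refine ⟨_, mem_nhdsWithin_of_mem_nhds (e1.and e2), δ, hδ0, |DD x a| + 1, ?_⟩
    rintro α ⟨h1, h2⟩
    exact ⟨a, ha0, ha1, le_of_lt h1, le_of_lt h2⟩
end XS

namespace XS
open Real

variable {ι : Type*} [Fintype ι]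

noncomputable def load {n : ℕ} (φ : ι → Fin n) (j : Fin n) : ℕ := (Finset.univ.filter (fun p => φ p = j)).card

noncomputable def CC (ι : Type*) [Fintype ι] (n : ℕ) : Finset (ι → Fin n) :=
  Finset.univ.filter (fun φ => ∀ j, 2 ≤ load φ j)

noncomputable def WW (n : ℕ) (v : ℕ → ℝ) (M : ℕ) : ℝ :=
  ∑ κ ∈ Finset.piAntidiag (Finset.univ : Finset (Fin n)) M, ∏ j, v (κ j)

lemma prod_X_load {n : ℕ} (φ : ι → Fin n) : ∏ i, (MvPolynomial.X (φ i) : MvPolynomial (Fin n) ℝ) =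
    MvPolynomial.monomial (Finsupp.equivFunOnFinite.symm (load φ)) 1 := by
  rw [← Finset.prod_fiberwise Finset.univ φ]
  rw [MvPolynomial.monomial_eq]
  simp only [map_one, one_mul]
  rw [Finsupp.prod_fintype _ _ (by simp)]
  apply Finset.prod_congr rfl
  intro j _
  rw [Finset.prod_congr rfl (g := fun _ => MvPolynomial.X j)]
  · simp [load]
  · intro i hi; simp at hi; rw [hi]

lemma genfun (n : ℕ) (w : ℕ → ℝ) : ∑ φ : ι → Fin n, ∏ j, w (load φ j) =
    (Fintype.card ι).factorial * WW n (fun a => w a / a.factorial) (Fintype.card ι) := by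
  set Λ := (MvPolynomial.basisMonomials (Fin n) ℝ).constr ℝ (fun d => ∏ j, w (d j)) with hΛ
  have hmon : ∀ d : Fin n →₀ ℕ, Λ (MvPolynomial.monomial d 1) = ∏ j, w (d j) := by
    intro d
    have := (MvPolynomial.basisMonomials (Fin n) ℝ).constr_basis ℝ (fun d => ∏ j, w (d j)) d
    rwa [MvPolynomial.coe_basisMonomials] at this
  have h1 : (∑ j, (MvPolynomial.X j : MvPolynomial (Fin n) ℝ)) ^ (Fintype.card ι) =
      ∑ φ : ι → Fin n, MvPolynomial.monomial (Finsupp.equivFunOnFinite.symm (load φ)) 1 := by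
    have h := Finset.prod_univ_sum (fun _ : ι => (Finset.univ : Finset (Fin n)))
      (fun _ j => (MvPolynomial.X j : MvPolynomial (Fin n) ℝ))
    rw [Finset.prod_const, Finset.card_univ, Fintype.piFinset_univ] at h
    rw [h]
    exact Finset.sum_congr rfl (fun φ _ => prod_X_load φ)
  have h2 := Finset.sum_pow_eq_sum_piAntidiag Finset.univ (fun j => (MvPolynomial.X j : MvPolynomial (Fin n) ℝ)) (Fintype.card ι)
  rw [h1] at h2
  have h3 := congrArg Λ h2
  rw [map_sum, map_sum] at h3
  simp only [hmon] at h3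
  simp only [Finsupp.equivFunOnFinite_symm_apply_apply] at h3
  rw [h3, WW, Finset.mul_sum]
  apply Finset.sum_congr rfl
  intro κ hκ
  rw [Finset.mem_piAntidiag] at hκ
  have e : (Nat.multinomial Finset.univ κ : MvPolynomial (Fin n) ℝ) * ∏ j, MvPolynomial.X j ^ κ j =
      (Nat.multinomial Finset.univ κ : ℝ) • MvPolynomial.monomial (Finsupp.equivFunOnFinite.symm κ) 1 := by
    rw [MvPolynomial.monomial_eq, Finsupp.prod_fintype _ _ (by simp), MvPolynomial.smul_eq_C_mul]
    simp
  rw [e, map_smul, hmon, smul_eq_mul]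
  have hs := Nat.multinomial_spec Finset.univ κ
  rw [hκ.1] at hs
  have hs' : (∏ j, ((κ j).factorial : ℝ)) * Nat.multinomial Finset.univ κ = (Fintype.card ι).factorial := by
    exact_mod_cast hs
  rw [← hs', Finset.prod_div_distrib]
  have : (∏ j, ((κ j).factorial : ℝ)) ≠ 0 := Finset.prod_ne_zero_iff.mpr (fun j _ => by positivity)
  simp only [Finsupp.equivFunOnFinite_symm_apply_apply]
  field_simp

lemma WW_nonneg {n : ℕ} {v : ℕ → ℝ} (hv : ∀ a, 0 ≤ v a) (M : ℕ) : 0 ≤ WW n v M :=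
  Finset.sum_nonneg (fun _ _ => Finset.prod_nonneg (fun _ _ => hv _))

lemma WW_mul_pow {n : ℕ} {v : ℕ → ℝ} {M : ℕ} (x : ℝ) :
    WW n v M * x ^ M = WW n (fun a => v a * x ^ a) M := by
  unfold WW
  rw [Finset.sum_mul]
  apply Finset.sum_congr rfl
  intro κ hκ
  rw [Finset.mem_piAntidiag] at hκ
  rw [Finset.prod_mul_distrib, Finset.prod_pow_eq_pow_sum, hκ.1]

lemma WW_le {n : ℕ} {v : ℕ → ℝ} (hv : ∀ a, 0 ≤ v a) (M : ℕ) :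
    WW n v M ≤ (∑ a ∈ Finset.range (M + 1), v a) ^ n := by
  have h := Finset.prod_univ_sum (fun _ : Fin n => Finset.range (M + 1)) (fun _ a => v a)
  rw [Finset.prod_const, Finset.card_univ, Fintype.card_fin] at h
  rw [h]
  apply Finset.sum_le_sum_of_subset_of_nonneg
  · intro κ hκ
    rw [Finset.mem_piAntidiag] at hκ
    rw [Fintype.mem_piFinset]
    intro j
    rw [Finset.mem_range, Nat.lt_succ_iff, ← hκ.1]
    exact Finset.single_le_sum (f := κ) (fun _ _ => Nat.zero_le _) (Finset.mem_univ j)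
  · intro _ _ _; exact Finset.prod_nonneg (fun _ _ => hv _)

lemma WW_lower {n : ℕ} {v : ℕ → ℝ} (hv : ∀ a, 0 ≤ v a) (A : ℕ) :
    (∑ a ∈ Finset.range (A + 1), v a) ^ n ≤ ∑ M ∈ Finset.range (n * A + 1), WW n v M := by
  have h := Finset.prod_univ_sum (fun _ : Fin n => Finset.range (A + 1)) (fun _ a => v a)
  rw [Finset.prod_const, Finset.card_univ, Fintype.card_fin] at h
  rw [h]
  rw [← Finset.sum_fiberwise_of_maps_to (s := Fintype.piFinset fun _ : Fin n => Finset.range (A + 1))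
    (t := Finset.range (n * A + 1)) (g := fun κ => ∑ j, κ j)]
  · apply Finset.sum_le_sum
    intro M _
    apply Finset.sum_le_sum_of_subset_of_nonneg
    · intro κ hκ
      rw [Finset.mem_filter] at hκ
      rw [Finset.mem_piAntidiag]
      exact ⟨hκ.2, fun _ _ => Finset.mem_univ _⟩
    · intro _ _ _; exact Finset.prod_nonneg (fun _ _ => hv _)
  · intro κ hκ
    rw [Fintype.mem_piFinset] at hκ
    rw [Finset.mem_range, Nat.lt_succ_iff]
    calc ∑ j, κ j ≤ ∑ j : Fin n, A := Finset.sum_le_sum (fun j _ => by have := hκ j; rw [Finset.mem_range] at this; omega)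
      _ = n * A := by simp

noncomputable def v2 (a : ℕ) : ℝ := if 2 ≤ a then 1 / (a.factorial : ℝ) else 0

lemma v2_nonneg (a : ℕ) : 0 ≤ v2 a := by unfold v2; split_ifs <;> positivity

lemma card_CC (n : ℕ) : ((CC ι n).card : ℝ) = (Fintype.card ι).factorial * WW n v2 (Fintype.card ι) := by
  have h := genfun (ι := ι) n (fun a => if 2 ≤ a then 1 else 0)
  have e : (fun a : ℕ => (if 2 ≤ a then (1:ℝ) else 0) / a.factorial) = v2 := by
    funext a; unfold v2; split_ifs <;> simp
  rw [e] at h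
  rw [← h, CC, Finset.card_filter]
  push_cast
  apply Finset.sum_congr rfl
  intro φ _
  rw [Finset.prod_ite_zero]
  simp

lemma sum_v2_le {x : ℝ} (hx : 0 ≤ x) (B : ℕ) : ∑ a ∈ Finset.range B, v2 a * x ^ a ≤ ff x := by
  have h : HasSum (fun a : ℕ => v2 a * x ^ a) (ff x) := by
    rw [← hasSum_nat_add_iff' 2]
    refine hs_congr (hasSum_ff x) (fun i => ?_) ?_
    · simp [v2]; ring
    · simp [Finset.sum_range_succ, v2]
  exact sum_le_hasSum _ (fun a _ => mul_nonneg (v2_nonneg a) (by positivity)) h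

lemma WW_v2_le {n M : ℕ} {x : ℝ} (hx : 0 ≤ x) : WW n v2 M * x ^ M ≤ ff x ^ n := by
  rw [WW_mul_pow]
  refine (WW_le (fun a => mul_nonneg (v2_nonneg a) (by positivity)) M).trans ?_
  apply pow_le_pow_left₀ (Finset.sum_nonneg (fun a _ => mul_nonneg (v2_nonneg a) (by positivity)))
  exact sum_v2_le hx _

/-- upper bound for the parity-weighted sum -/
lemma parity_upper {n : ℕ} {x t : ℝ} (hx : 0 < x) (ht0 : |t| ≤ 1) :
    ∑ φ ∈ CC ι n, ∏ j, ((1 + t ^ load φ j) / 2) ≤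
      (Fintype.card ι).factorial / x ^ Fintype.card ι * ((ff x + ff (t * x)) / 2) ^ n := by
  set w : ℕ → ℝ := fun a => if 2 ≤ a then (1 + t ^ a) / 2 else 0 with hw
  have hpow : ∀ a : ℕ, -1 ≤ t ^ a := fun a => by
    have : |t ^ a| ≤ 1 := by rw [abs_pow]; exact pow_le_one₀ (abs_nonneg _) ht0
    exact (abs_le.mp this).1
  have hw0 : ∀ a, 0 ≤ w a := fun a => by
    simp only [hw]; split_ifs
    · linarith [hpow a]
    · rfl
  have h := genfun (ι := ι) n w
  set N := Fintype.card ι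
  have h1 : ∑ φ ∈ CC ι n, ∏ j, ((1 + t ^ load φ j) / 2) ≤ ∑ φ : ι → Fin n, ∏ j, w (load φ j) := by
    rw [CC, Finset.sum_filter]
    apply Finset.sum_le_sum
    intro φ _
    split_ifs with hφ
    · apply le_of_eq
      apply Finset.prod_congr rfl
      intro j _
      simp [hw, hφ j]
    · exact Finset.prod_nonneg (fun j _ => hw0 _)
  refine h1.trans ?_
  rw [h, div_mul_eq_mul_div, mul_div_assoc]
  apply mul_le_mul_of_nonneg_left _ (by positivity)
  rw [le_div_iff₀ (by positivity), WW_mul_pow]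
  have hn : ∀ a : ℕ, 0 ≤ w a / a.factorial * x ^ a := fun a => by have := hw0 a; positivity
  refine (WW_le hn N).trans ?_
  apply pow_le_pow_left₀ (Finset.sum_nonneg (fun a _ => hn a))
  have hs : HasSum (fun a : ℕ => w a / a.factorial * x ^ a) ((ff x + ff (t * x)) / 2) := by
    rw [← hasSum_nat_add_iff' 2]
    refine hs_congr (((hasSum_ff x).add (hasSum_ff_mul x t)).div_const 2) (fun i => ?_) ?_
    · simp [hw]; ring
    · simp [Finset.sum_range_succ, hw]
  exact sum_le_hasSum _ (fun a _ => hn a) hs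
end XS

namespace XS
open Real

variable {ι : Type*} [Fintype ι]

def EvenOn {n : ℕ} (T : Finset ι) (φ : ι → Fin n) : Prop := ∀ j, Even (T.filter (fun p => φ p = j)).card

noncomputable def EC (n : ℕ) (T : Finset ι) : ℕ := ((CC ι n).filter (EvenOn T)).card

lemma prod_fib {n : ℕ} (φ : ι → Fin n) (S : Finset ι) (J : Finset (Fin n)) (c : ℝ) :
    ∏ j ∈ J, c ^ (S.filter (fun p => φ p = j)).card = ∏ i ∈ S, (if φ i ∈ J then c else 1) := by
  rw [← Finset.prod_fiberwise S φ]
  have : ∀ j, ∏ i ∈ S with φ i = j, (if φ i ∈ J then c else 1) =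
      if j ∈ J then c ^ (S.filter (fun p => φ p = j)).card else 1 := by
    intro j
    rw [Finset.prod_congr rfl (g := fun _ => if j ∈ J then c else 1)]
    · rw [Finset.prod_const]; split_ifs <;> simp
    · intro i hi; rw [Finset.mem_filter] at hi; rw [hi.2]
  simp only [this]
  rw [Finset.prod_ite_mem]; simp

lemma parity_expand {n : ℕ} (φ : ι → Fin n) (a : ℝ) :
    ∑ T : Finset ι, (if EvenOn T φ then a ^ T.card * (1 - a) ^ (Fintype.card ι - T.card) else 0) =
      ∏ j, ((1 + (1 - 2 * a) ^ load φ j) / 2) := by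
  have hind : ∀ T : Finset ι, (if EvenOn T φ then (1:ℝ) else 0) =
      ∏ j, ((1 + (-1) ^ (T.filter (fun p => φ p = j)).card) / 2) := by
    intro T
    have : ∀ j, ((1 + (-1:ℝ) ^ (T.filter (fun p => φ p = j)).card) / 2) =
        if Even (T.filter (fun p => φ p = j)).card then 1 else 0 := by
      intro j
      split_ifs with h
      · rw [h.neg_one_pow]; norm_num
      · rw [(Nat.not_even_iff_odd.mp h).neg_one_pow]; norm_num
    simp only [this]
    rw [Finset.prod_ite_zero]
    by_cases h : EvenOn T φ
    · rw [if_pos h, if_pos (fun j _ => h j)]; simp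
    · rw [if_neg h, if_neg (fun h' => h (fun j => h' j (Finset.mem_univ j)))]
  have hexp : ∀ T : Finset ι, (if EvenOn T φ then (1:ℝ) else 0) =
      (1 / 2) ^ n * ∑ J : Finset (Fin n), ∏ i ∈ T, (if φ i ∈ J then -1 else 1) := by
    intro T
    rw [hind, Finset.prod_div_distrib, Finset.prod_one_add]
    simp only [Finset.prod_const, Finset.card_univ, Fintype.card_fin, Finset.powerset_univ]
    rw [div_eq_mul_inv, mul_comm, one_div, inv_pow]
    congr 1
    apply Finset.sum_congr rfl
    intro J _
    exact prod_fib φ T J (-1)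
  have e1 : ∀ T : Finset ι, (if EvenOn T φ then a ^ T.card * (1 - a) ^ (Fintype.card ι - T.card) else 0) =
      (1 / 2) ^ n * ∑ J : Finset (Fin n), ((∏ i ∈ T, (a * (if φ i ∈ J then -1 else 1))) * ∏ i ∈ Finset.univ \ T, (1 - a)) := by
    intro T
    have : (if EvenOn T φ then a ^ T.card * (1 - a) ^ (Fintype.card ι - T.card) else 0) =
      (if EvenOn T φ then (1:ℝ) else 0) * (a ^ T.card * (1 - a) ^ (Fintype.card ι - T.card)) := by
      split_ifs <;> simp
    rw [this, hexp, mul_assoc, Finset.sum_mul]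
    congr 1
    apply Finset.sum_congr rfl
    intro J _
    rw [Finset.prod_mul_distrib, Finset.prod_const, Finset.prod_const, ← Finset.compl_eq_univ_sdiff, Finset.card_compl]
    ring
  simp only [e1]
  rw [← Finset.mul_sum, Finset.sum_comm]
  have e2 : ∀ J : Finset (Fin n), ∑ T : Finset ι, ((∏ i ∈ T, (a * (if φ i ∈ J then -1 else 1))) * ∏ i ∈ Finset.univ \ T, (1 - a))
      = ∏ j ∈ J, (1 - 2 * a) ^ load φ j := by
    intro J
    have := Finset.prod_add (fun i : ι => a * (if φ i ∈ J then (-1:ℝ) else 1)) (fun _ => 1 - a) Finset.univ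
    rw [Finset.powerset_univ] at this
    rw [← this]
    unfold load
    rw [prod_fib φ Finset.univ J (1 - 2 * a)]
    apply Finset.prod_congr rfl
    intro i _
    split_ifs <;> ring
  simp only [e2]
  rw [Finset.prod_div_distrib, Finset.prod_one_add]
  simp only [Finset.prod_const, Finset.card_univ, Fintype.card_fin, Finset.powerset_univ]
  rw [one_div, inv_pow]; ring

lemma load_comp {n : ℕ} (φ : ι → Fin n) (σ : Equiv.Perm ι) (j : Fin n) : load (φ ∘ σ) j = load φ j := by
  unfold load
  apply Finset.card_bij (fun p _ => σ p)
  · intro p hp; simpa using hp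
  · intro p _ q _ h; exact σ.injective h
  · intro q hq; exact ⟨σ.symm q, by simpa using hq, by simp⟩

lemma EC_perm {n : ℕ} (T : Finset ι) (σ : Equiv.Perm ι) : EC n T ≤ EC n (T.map σ.toEmbedding) := by
  unfold EC
  apply Finset.card_le_card_of_injOn (fun φ => φ ∘ σ.symm)
  · intro φ hφ
    simp only [Finset.coe_filter, Set.mem_ofPred_eq, CC, Finset.mem_filter, Finset.mem_univ, true_and] at hφ ⊢
    refine ⟨fun j => by rw [load_comp]; exact hφ.1 j, fun j => ?_⟩
    have : ((T.map σ.toEmbedding).filter (fun p => (φ ∘ σ.symm) p = j)).card = (T.filter (fun p => φ p = j)).card := by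
      rw [Finset.filter_map, Finset.card_map]
      congr 1
      ext p; simp
    rw [this]; exact hφ.2 j
  · intro φ _ φ' _ h
    funext p
    have := congrFun h (σ p)
    simpa using this

lemma EC_le_of_card {n : ℕ} {T T' : Finset ι} (h : T.card = T'.card) : EC n T ≤ EC n T' := by
  obtain ⟨e⟩ : Nonempty ({x // x ∈ T} ≃ {x // x ∈ T'}) := by
    rw [← Fintype.card_eq]; simpa using h
  have := EC_perm (n := n) T (Equiv.extendSubtype e)
  convert this using 2
  ext p
  simp only [Finset.mem_map, Equiv.coe_toEmbedding]
  constructor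
  · intro hp
    refine ⟨e.symm ⟨p, hp⟩, (e.symm ⟨p, hp⟩).2, ?_⟩
    rw [Equiv.extendSubtype_apply_of_mem _ _ (e.symm ⟨p, hp⟩).2]; simp
  · rintro ⟨q, hq, rfl⟩
    exact Equiv.extendSubtype_mem _ _ hq

lemma EC_card {n : ℕ} {T T' : Finset ι} (h : T.card = T'.card) : EC n T = EC n T' :=
  le_antisymm (EC_le_of_card h) (EC_le_of_card h.symm)

/-- main bound in the large regime -/
lemma EC_upper {n : ℕ} (T : Finset ι) {a x : ℝ} (ha0 : 0 < a) (ha1 : a < 1) (hx : 0 < x) :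
    ((Fintype.card ι).choose T.card : ℝ) * (a ^ T.card * (1 - a) ^ (Fintype.card ι - T.card)) * EC n T ≤
      (Fintype.card ι).factorial / x ^ Fintype.card ι * ((ff x + ff ((1 - 2 * a) * x)) / 2) ^ n := by
  refine le_trans ?_ (parity_upper (ι := ι) (n := n) (t := 1 - 2 * a) hx (by rw [abs_le]; constructor <;> linarith))
  set N := Fintype.card ι
  have h1 : ∑ φ ∈ CC ι n, ∏ j, ((1 + (1 - 2 * a) ^ load φ j) / 2) =
      ∑ S : Finset ι, (a ^ S.card * (1 - a) ^ (N - S.card)) * EC n S := by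
    simp only [← parity_expand]
    rw [Finset.sum_comm]
    apply Finset.sum_congr rfl
    intro S _
    rw [← Finset.sum_filter, Finset.sum_const, nsmul_eq_mul, mul_comm, EC]
  rw [h1]
  calc _ = ∑ S ∈ (Finset.univ : Finset ι).powersetCard T.card, (a ^ S.card * (1 - a) ^ (N - S.card)) * (EC n S : ℝ) := by
        rw [Finset.sum_congr rfl (g := fun _ => (a ^ T.card * (1 - a) ^ (N - T.card)) * (EC n T : ℝ))]
        · rw [Finset.sum_const, Finset.card_powersetCard, Finset.card_univ, nsmul_eq_mul]; ring
        · intro S hS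
          rw [Finset.mem_powersetCard] at hS
          rw [EC_card hS.2, hS.2]
    _ ≤ _ := by
        apply Finset.sum_le_sum_of_subset_of_nonneg (Finset.subset_univ _)
        intro S _ _
        have : 0 < 1 - a := by linarith
        positivity

end XS

namespace XS
open Real

variable {ι : Type*} [Fintype ι]

lemma EC_odd {n : ℕ} {T : Finset ι} (h : ¬ Even T.card) : EC n T = 0 := by
  unfold EC
  rw [Finset.card_eq_zero, Finset.filter_eq_empty_iff]
  intro φ _ hE
  apply h
  rw [Finset.card_eq_sum_card_fiberwise (f := φ) (t := Finset.univ) (fun _ _ => by simp)]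
  exact Finset.even_sum _ (fun j _ => hE j)

lemma EvenOn_erase {n : ℕ} {T : Finset ι} {p q : ι} (hp : p ∈ T) (hq : q ∈ T) (hpq : q ≠ p)
    {φ : ι → Fin n} (h : EvenOn T φ) (he : φ q = φ p) : EvenOn ((T.erase p).erase q) φ := by
  intro j
  rw [Finset.filter_erase, Finset.filter_erase]
  by_cases hj : φ p = j
  · have h1 : p ∈ T.filter (fun x => φ x = j) := by simp [hp, hj]
    have h2 : q ∈ (T.filter (fun x => φ x = j)).erase p := by simp [hq, hpq, he, hj]
    have a := Finset.card_erase_add_one h1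
    have b := Finset.card_erase_add_one h2
    have := h j
    rw [← a, ← b] at this
    rw [Nat.even_iff] at this ⊢
    omega
  · rw [Finset.erase_eq_of_notMem, Finset.erase_eq_of_notMem]
    · exact h j
    · simp [hj]
    · simp [hj, he]

lemma EvenOn_congr {n : ℕ} {T : Finset ι} {φ ψ : ι → Fin n} (h : ∀ x ∈ T, φ x = ψ x) (hE : EvenOn T φ) : EvenOn T ψ := by
  intro j
  have := hE j
  rwa [Finset.filter_congr (q := fun x => ψ x = j)] at this
  intro x hx; rw [h x hx]

lemma switch3 {n : ℕ} {T : Finset ι} {p q : ι} (hp : p ∈ T) (hq : q ∈ T) (hpq : q ≠ p) :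
    n * ((CC ι n).filter (fun φ => EvenOn T φ ∧ φ q = φ p ∧ 3 ≤ load φ (φ p))).card ≤ EC n ((T.erase p).erase q) := by
  have e : n * ((CC ι n).filter (fun φ => EvenOn T φ ∧ φ q = φ p ∧ 3 ≤ load φ (φ p))).card =
    ((Finset.univ : Finset (Fin n)) ×ˢ ((CC ι n).filter (fun φ => EvenOn T φ ∧ φ q = φ p ∧ 3 ≤ load φ (φ p)))).card := by
    rw [Finset.card_product]; simp
  rw [e, EC]
  apply Finset.card_le_card_of_injOn (fun x => Function.update x.2 q x.1)
  · rintro ⟨j, φ⟩ hx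
    simp only [Finset.coe_product, Set.mem_prod, Finset.coe_filter, Set.mem_ofPred_eq, CC, Finset.mem_filter, Finset.mem_univ, true_and, Finset.coe_univ, Set.mem_univ] at hx ⊢
    obtain ⟨h1, h2, h3, h4⟩ := hx
    constructor
    · intro i
      have hsub : (Finset.univ.filter (fun x => φ x = i)).erase q ⊆ Finset.univ.filter (fun x => Function.update φ q j x = i) := by
        intro x hx
        simp only [Finset.mem_erase, Finset.mem_filter, Finset.mem_univ, true_and] at hx ⊢
        rw [Function.update_of_ne hx.1]; exact hx.2
      have hc := Finset.card_le_card hsub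
      unfold load at *
      by_cases hi : φ p = i
      · subst hi
        have := Finset.pred_card_le_card_erase (s := Finset.univ.filter (fun x => φ x = φ p)) (a := q)
        omega
      · rw [Finset.erase_eq_of_notMem (by simp [h3, hi])] at hc
        exact (h1 i).trans hc
    · refine EvenOn_congr ?_ (EvenOn_erase hp hq hpq h2 h3)
      intro x hx
      simp only [Finset.mem_erase] at hx
      rw [Function.update_of_ne hx.1]
  · rintro ⟨j, φ⟩ hx ⟨j', φ'⟩ hx' h
    simp only [Finset.coe_product, Set.mem_prod, Finset.coe_filter, Set.mem_ofPred_eq] at hx hx' h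
    have hj : j = j' := by have := congrFun h q; simpa using this
    have hφ : φ = φ' := by
      funext x
      have hpp : φ p = φ' p := by
        have := congrFun h p
        rwa [Function.update_of_ne hpq.symm, Function.update_of_ne hpq.symm] at this
      by_cases hxq : x = q
      · rw [hxq, hx.2.2.2.1, hx'.2.2.2.1, hpp]
      · have := congrFun h x
        rwa [Function.update_of_ne hxq, Function.update_of_ne hxq] at this
    rw [hj, hφ]

lemma switch2 {n : ℕ} {T : Finset ι} {p q : ι} (hp : p ∈ T) (hq : q ∈ T) (hpq : q ≠ p) :
    (Fintype.card ι - T.card) * ((CC ι n).filter (fun φ => EvenOn T φ ∧ φ q = φ p ∧ ¬ 3 ≤ load φ (φ p))).card ≤ EC n ((T.erase p).erase q) := by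
  have e : (Fintype.card ι - T.card) * ((CC ι n).filter (fun φ => EvenOn T φ ∧ φ q = φ p ∧ ¬ 3 ≤ load φ (φ p))).card =
    (Tᶜ ×ˢ ((CC ι n).filter (fun φ => EvenOn T φ ∧ φ q = φ p ∧ ¬ 3 ≤ load φ (φ p)))).card := by
    rw [Finset.card_product, Finset.card_compl]
  rw [e, EC]
  apply Finset.card_le_card_of_injOn (fun x => x.2 ∘ Equiv.swap q x.1)
  · rintro ⟨r, φ⟩ hx
    simp only [Finset.coe_product, Set.mem_prod, Finset.coe_filter, Set.mem_ofPred_eq, CC, Finset.mem_filter, Finset.mem_univ, true_and, Finset.mem_coe, Finset.mem_compl] at hx ⊢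
    obtain ⟨hr, h1, h2, h3, h4⟩ := hx
    refine ⟨fun j => by rw [load_comp]; exact h1 j, ?_⟩
    refine EvenOn_congr ?_ (EvenOn_erase hp hq hpq h2 h3)
    intro x hx
    simp only [Finset.mem_erase] at hx
    have hxr : x ≠ r := by rintro rfl; exact hr hx.2.2
    rw [Function.comp_apply, Equiv.swap_apply_of_ne_of_ne hx.1 hxr]
  · have key : ∀ r φ, r ∉ T → φ ∈ (CC ι n).filter (fun φ => EvenOn T φ ∧ φ q = φ p ∧ ¬ 3 ≤ load φ (φ p)) →
      ∀ x, x ≠ p → (φ ∘ Equiv.swap q r) x = (φ ∘ Equiv.swap q r) p → x = r := by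
      intro r φ hr hφ x hxp hx
      simp only [Finset.mem_filter] at hφ
      have hpr : p ≠ r := by rintro rfl; exact hr hp
      rw [Function.comp_apply, Function.comp_apply, Equiv.swap_apply_of_ne_of_ne hpq.symm hpr] at hx
      by_contra hxr
      apply hφ.2.2.2
      have h3 : ({p, q, Equiv.swap q r x} : Finset ι).card = 3 := by
        rw [Finset.card_eq_three]
        refine ⟨p, q, _, hpq.symm, ?_, ?_, rfl⟩
        · intro h
          apply hxp
          have := congrArg (Equiv.swap q r) h
          rw [Equiv.swap_apply_self, Equiv.swap_apply_of_ne_of_ne hpq.symm hpr] at this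
          exact this.symm
        · intro h
          have := congrArg (Equiv.swap q r) h
          rw [Equiv.swap_apply_self, Equiv.swap_apply_left] at this
          exact hxr this.symm
      rw [← h3]
      apply Finset.card_le_card
      intro y hy
      simp only [Finset.mem_insert, Finset.mem_singleton] at hy
      simp only [Finset.mem_filter, Finset.mem_univ, true_and]
      rcases hy with rfl | rfl | rfl
      · rfl
      · exact hφ.2.2.1
      · exact hx
    rintro ⟨r, φ⟩ hx ⟨r', φ'⟩ hx' h
    simp only [Finset.coe_product, Set.mem_prod, Finset.mem_coe, Finset.mem_compl] at hx hx' h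
    have hrr : r = r' := by
      apply key r' φ' hx'.1 hx'.2
      · rintro rfl; exact hx.1 hp
      · rw [← h]
        have hpr : p ≠ r := by rintro rfl; exact hx.1 hp
        rw [Function.comp_apply, Function.comp_apply, Equiv.swap_apply_right, Equiv.swap_apply_of_ne_of_ne hpq.symm hpr]
        have := hx.2
        simp only [Finset.mem_filter] at this
        exact this.2.2.1
    subst hrr
    have : φ = φ' := by
      funext x
      have := congrFun h (Equiv.swap q r x)
      simpa using this
    rw [this]

lemma switch_step {n : ℕ} (hn : 0 < n) {T T' : Finset ι} (hT : T.card < Fintype.card ι) (hTT : T.card = T'.card + 2) :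
    (EC n T : ℝ) ≤ (T'.card + 1 : ℝ) * (1 / n + 1 / (Fintype.card ι - T.card : ℝ)) * EC n T' := by
  obtain ⟨p, hp⟩ : T.Nonempty := Finset.card_pos.mp (by omega)
  have hsub : (CC ι n).filter (EvenOn T) ⊆ (T.erase p).biUnion (fun q => (CC ι n).filter (fun φ => EvenOn T φ ∧ φ q = φ p)) := by
    intro φ hφ
    simp only [Finset.mem_filter] at hφ
    have hE := hφ.2 (φ p)
    have h1 : p ∈ T.filter (fun x => φ x = φ p) := by simp [hp]
    have h2 : 1 < (T.filter (fun x => φ x = φ p)).card := by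
      have := Finset.card_pos.mpr ⟨p, h1⟩
      rw [Nat.even_iff] at hE
      omega
    obtain ⟨q, hq, hqp⟩ := Finset.exists_mem_ne h2 p
    simp only [Finset.mem_filter] at hq
    simp only [Finset.mem_biUnion, Finset.mem_filter, Finset.mem_erase]
    exact ⟨q, ⟨hqp, hq.1⟩, hφ.1, hφ.2, hq.2⟩
  have h1 : EC n T ≤ ∑ q ∈ T.erase p, ((CC ι n).filter (fun φ => EvenOn T φ ∧ φ q = φ p)).card :=
    (Finset.card_le_card hsub).trans Finset.card_biUnion_le
  have hd : (0:ℝ) < (Fintype.card ι : ℝ) - T.card := by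
    have : (T.card : ℝ) < Fintype.card ι := by exact_mod_cast hT
    linarith
  have hn' : (0:ℝ) < n := by exact_mod_cast hn
  have h2 : ∀ q ∈ T.erase p, (((CC ι n).filter (fun φ => EvenOn T φ ∧ φ q = φ p)).card : ℝ) ≤
      (1 / n + 1 / (Fintype.card ι - T.card : ℝ)) * EC n T' := by
    intro q hq
    rw [Finset.mem_erase] at hq
    have hce : ((T.erase p).erase q).card = T'.card := by
      rw [Finset.card_erase_of_mem (by simp [hq.1, hq.2]), Finset.card_erase_of_mem hp]; omega
    have a3 := switch3 (n := n) hp hq.2 hq.1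
    have a2 := switch2 (n := n) hp hq.2 hq.1
    rw [EC_card hce] at a3 a2
    have a3' : (n : ℝ) * (((CC ι n).filter (fun φ => EvenOn T φ ∧ φ q = φ p ∧ 3 ≤ load φ (φ p))).card : ℝ) ≤ EC n T' := by
      exact_mod_cast a3
    have a2' : ((Fintype.card ι : ℝ) - T.card) * (((CC ι n).filter (fun φ => EvenOn T φ ∧ φ q = φ p ∧ ¬ 3 ≤ load φ (φ p))).card : ℝ) ≤ EC n T' := by
      rw [← Nat.cast_sub hT.le]; exact_mod_cast a2
    have hs := Finset.card_filter_add_card_filter_not (s := (CC ι n).filter (fun φ => EvenOn T φ ∧ φ q = φ p)) (fun φ => 3 ≤ load φ (φ p))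
    rw [Finset.filter_filter, Finset.filter_filter] at hs
    simp only [and_assoc] at hs
    rw [← hs]
    push_cast
    rw [add_mul, one_div_mul_eq_div, one_div_mul_eq_div]
    apply add_le_add
    · rw [le_div_iff₀ hn']; linarith
    · rw [le_div_iff₀ hd]; linarith
  calc (EC n T : ℝ) ≤ ∑ q ∈ T.erase p, (((CC ι n).filter (fun φ => EvenOn T φ ∧ φ q = φ p)).card : ℝ) := by exact_mod_cast h1
    _ ≤ ∑ q ∈ T.erase p, (1 / n + 1 / (Fintype.card ι - T.card : ℝ)) * EC n T' := Finset.sum_le_sum h2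
    _ = _ := by
      rw [Finset.sum_const, Finset.card_erase_of_mem hp, hTT, nsmul_eq_mul]
      push_cast
      ring

open Nat in
lemma switch_main {n : ℕ} (hn : 0 < n) {K : ℕ} (hK : K < Fintype.card ι) (s : ℕ) (hs : 2 * s ≤ K) (T : Finset ι) (hT : T.card = 2 * s) :
    (EC n T : ℝ) ≤ ((2 * s - 1)‼ : ℕ) * (1 / n + 1 / (Fintype.card ι - K : ℝ)) ^ s * (CC ι n).card := by
  have hd : (0:ℝ) < (Fintype.card ι : ℝ) - K := by
    have : (K : ℝ) < Fintype.card ι := by exact_mod_cast hK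
    linarith
  have hn' : (0:ℝ) < n := by exact_mod_cast hn
  induction s generalizing T with
  | zero =>
    simp [EC]
    exact_mod_cast Finset.card_le_card (Finset.filter_subset _ _)
  | succ s ih =>
    obtain ⟨T', hT'sub, hT'⟩ := Finset.exists_subset_card_eq (s := T) (n := 2 * s) (by omega)
    have h1 := switch_step hn (T := T) (T' := T') (by omega) (by omega)
    have h2 := ih (by omega) T' hT'
    rw [hT'] at h1
    have hB : (1 / n + 1 / (Fintype.card ι - T.card : ℝ)) ≤ (1 / n + 1 / (Fintype.card ι - K : ℝ)) := by
      have : (T.card : ℝ) ≤ K := by exact_mod_cast (by omega : T.card ≤ K)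
      gcongr
    have hdf : ((2 * (s + 1) - 1)‼ : ℕ) = (2 * s + 1) * (2 * s - 1)‼ := by
      rcases s with _ | s
      · simp
      · rw [show 2 * (s + 1 + 1) - 1 = (2 * s + 1) + 2 by omega, Nat.doubleFactorial_add_two]
        rfl
    rw [hdf, pow_succ]
    set B := (1 / n + 1 / (Fintype.card ι - K : ℝ)) with hBdef
    calc (EC n T : ℝ) ≤ ((2 * s : ℕ) + 1 : ℝ) * (1 / n + 1 / (Fintype.card ι - T.card : ℝ)) * EC n T' := h1
      _ ≤ ((2 * s : ℕ) + 1 : ℝ) * B * (((2 * s - 1)‼ : ℕ) * B ^ s * (CC ι n).card) := by gcongr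
      _ = _ := by push_cast; ring
end XS

namespace XS
open Real

lemma chipSet_eq (k m n : ℕ) : chipSet k m n = CC (Fin m × Fin k) n := by
  unfold chipSet CC load
  congr!

lemma evenOn_iff {k m n : ℕ} (S : Finset (Fin m)) (φ : Fin m × Fin k → Fin n) :
    EvenOn (S ×ˢ (Finset.univ : Finset (Fin k))) φ ↔ ∀ j : Fin n,
      Even (∑ i ∈ S, (Finset.univ.filter (fun u : Fin k => φ (i, u) = j)).card) := by
  unfold EvenOn
  refine forall_congr' (fun j => ?_)
  rw [Finset.card_filter, Finset.sum_product]
  simp only [Finset.card_filter]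

lemma EY_eq {k m n ℓ : ℕ} (T : Finset (Fin m × Fin k)) (hT : T.card = k * ℓ) :
    EY k m n ℓ = (m.choose ℓ : ℝ) * EC n T / (CC (Fin m × Fin k) n).card := by
  unfold EY
  rw [chipSet_eq]
  congr 1
  have h : ∀ φ, Ycount k m n ℓ φ = ∑ S ∈ Finset.powersetCard ℓ (Finset.univ : Finset (Fin m)),
      if EvenOn (S ×ˢ (Finset.univ : Finset (Fin k))) φ then 1 else 0 := by
    intro φ
    unfold Ycount
    rw [← Finset.card_filter]
    congr 1
    ext S
    simp only [Finset.mem_filter, Finset.mem_univ, true_and, Finset.mem_powersetCard, Finset.subset_univ, evenOn_iff]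
  have h2 : ∑ φ ∈ CC (Fin m × Fin k) n, Ycount k m n ℓ φ = m.choose ℓ * EC n T := by
    simp only [h]
    rw [Finset.sum_comm]
    have : ∀ S ∈ Finset.powersetCard ℓ (Finset.univ : Finset (Fin m)),
        (∑ φ ∈ CC (Fin m × Fin k) n, if EvenOn (S ×ˢ (Finset.univ : Finset (Fin k))) φ then 1 else 0) = EC n T := by
      intro S hS
      rw [← Finset.card_filter]
      change EC n _ = _
      apply EC_card
      rw [Finset.mem_powersetCard] at hS
      rw [Finset.card_product, hS.2, hT]
      simp [mul_comm]
    rw [Finset.sum_congr rfl this, Finset.sum_const, Finset.card_powersetCard]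
    simp
  exact_mod_cast h2

lemma exists_T {k m ℓ : ℕ} (h : ℓ ≤ m) : ∃ T : Finset (Fin m × Fin k), T.card = k * ℓ := by
  obtain ⟨T, _, hT⟩ := Finset.exists_subset_card_eq (s := (Finset.univ : Finset (Fin m × Fin k))) (n := k * ℓ)
    (by simp; rw [mul_comm k]; exact Nat.mul_le_mul_right _ h)
  exact ⟨T, hT⟩

lemma EY_nonneg (k m n ℓ : ℕ) : 0 ≤ EY k m n ℓ := by unfold EY; positivity

lemma fact_upper (n : ℕ) (hn : 1 ≤ n) : (n.factorial : ℝ) ≤ exp 1 * n * (n / exp 1) ^ n := by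
  induction n, hn using Nat.le_induction with
  | base => simp
  | succ n hn ih =>
    have hn0 : (0:ℝ) < n := by exact_mod_cast hn
    rw [Nat.factorial_succ]
    push_cast
    have h1 : exp 1 * (n:ℝ) ^ (n+1) ≤ (n + 1) ^ (n+1) := by
      have h : exp (1/(n+1:ℝ)) * n ≤ n + 1 := by
        have h2 := add_one_le_exp (-(1/(n+1:ℝ)))
        rw [exp_neg] at h2
        have h3 : (n:ℝ) / (n+1) ≤ (exp (1/(n+1:ℝ)))⁻¹ := by
          refine le_trans (le_of_eq ?_) h2; field_simp; ring
        rw [div_le_iff₀ (by positivity), inv_mul_eq_div, le_div_iff₀ (exp_pos _)] at h3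
        linarith
      calc exp 1 * (n:ℝ) ^ (n+1) = (exp (1/(n+1:ℝ)) * n) ^ (n+1) := by
            rw [mul_pow, ← exp_nat_mul]; congr 2; push_cast; field_simp
        _ ≤ _ := by gcongr
    calc ((n:ℝ)+1) * n.factorial ≤ (n+1) * (exp 1 * n * (n / exp 1) ^ n) := by gcongr
      _ = (n+1) * (exp 1 * (n:ℝ)^(n+1)) / exp 1 ^ n := by rw [div_pow]; field_simp; try ring
      _ ≤ (n+1) * ((n + 1) ^ (n+1)) / exp 1 ^ n := by gcongr
      _ = _ := by rw [div_pow]; field_simp; try ring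

lemma fact_lower (n : ℕ) : ((n:ℝ) / exp 1) ^ n ≤ n.factorial := by
  have h := Real.pow_div_factorial_le_exp (n:ℝ) (by positivity) n
  rw [div_le_iff₀ (by positivity)] at h
  rw [div_pow, div_le_iff₀ (by positivity), ← exp_nat_mul, mul_one]
  linarith

lemma choose_upper (m ℓ : ℕ) (hℓ : 1 ≤ ℓ) : (m.choose ℓ : ℝ) ≤ (exp 1 * m / ℓ) ^ ℓ := by
  have h0 : (0:ℝ) < ℓ := by exact_mod_cast hℓ
  calc (m.choose ℓ : ℝ) ≤ (m:ℝ) ^ ℓ / ℓ.factorial := Nat.choose_le_pow_div ℓ m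
    _ ≤ (m:ℝ) ^ ℓ / (((ℓ:ℝ) / exp 1) ^ ℓ) := by gcongr; exact fact_lower ℓ
    _ = _ := by rw [← div_pow]; congr 1; field_simp

open Nat in
lemma dfact_sq (s : ℕ) : (((2 * s - 1)‼ : ℕ) : ℝ) ^ 2 ≤ ((2 * s)! : ℕ) := by
  rcases s with _ | s
  · simp
  · have h1 : (2 * (s+1))! = (2*s+2)‼ * (2*s+1)‼ := Nat.factorial_eq_mul_doubleFactorial (2*s+1)
    have h2 : ∀ s : ℕ, (2*s+1)‼ ≤ (2*s+2)‼ := by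
      intro s
      induction s with
      | zero => decide
      | succ s ih =>
        rw [show 2*(s+1)+1 = (2*s+1)+2 by ring, show 2*(s+1)+2 = (2*s+2)+2 by ring, Nat.doubleFactorial_add_two, Nat.doubleFactorial_add_two]
        gcongr; omega
    have : ((2*s+1)‼)^2 ≤ (2*(s+1))! := by rw [h1, sq]; exact Nat.mul_le_mul_right _ (h2 s)
    exact_mod_cast this

noncomputable def D0 (k : ℕ) : ℝ := k + 1 / (1 - 1 / (max 10 k : ℝ))

lemma r_lt_one {k : ℕ} (hk : 4 ≤ k) : D0 k ^ 2 * (D0 k * (1 / (max 10 k : ℝ)) / exp 1) ^ (k - 2) < 1 := by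
  have he : (2.7182818283:ℝ) < exp 1 := exp_one_gt_d9
  have key : ∀ A B : ℝ, 0 ≤ A → 0 ≤ B → A ^ 2 * (B / 2.7182818283) ^ (k-2) < 1 → A ^ 2 * (B / exp 1) ^ (k-2) < 1 := by
    intro A B hA hB h
    refine lt_of_le_of_lt ?_ h
    gcongr
  have hm : (10:ℝ) ≤ max 10 (k:ℝ) := le_max_left _ _
  have h1 : 0 < 1 - 1 / (max 10 k : ℝ) := by
    have : 1 / (max 10 k : ℝ) ≤ 1 / 10 := by gcongr
    linarith
  have hD : 0 ≤ D0 k := by unfold D0; positivity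
  apply key _ _ hD (by positivity)
  by_cases h10 : k < 10
  · have : max (10:ℝ) k = 10 := max_eq_left (by exact_mod_cast h10.le)
    unfold D0
    rw [this]
    interval_cases k <;> norm_num
  · have h10' : 10 ≤ k := by omega
    have hk10 : (10:ℝ) ≤ k := by exact_mod_cast h10'
    have : max (10:ℝ) k = k := max_eq_right hk10
    have hDle : D0 k ≤ 10 / 9 * k := by
      unfold D0
      rw [this]
      have : 1 / (1 - 1 / (k:ℝ)) ≤ 10/9 := by
        rw [div_le_div_iff₀ (by rw [this] at h1; exact h1) (by norm_num)]
        have : 1 / (k:ℝ) ≤ 1/10 := by gcongr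
        linarith
      linarith
    rw [this] 
    have hb : D0 k * (1 / (k:ℝ)) / 2.7182818283 ≤ 0.41 := by
      have : D0 k * (1 / (k:ℝ)) ≤ 10 / 9 := by
        rw [mul_one_div, div_le_iff₀ (by positivity)]; exact hDle
      rw [div_le_iff₀ (by norm_num)]
      linarith
    have hfin : ∀ k : ℕ, 10 ≤ k → (10 / 9 * (k:ℝ)) ^ 2 * 0.41 ^ (k-2) < 1 := by
      intro k hk
      induction k, hk using Nat.le_induction with
      | base => norm_num
      | succ n hn ih =>
        have hn' : (10:ℝ) ≤ n := by exact_mod_cast hn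
        rw [show n + 1 - 2 = (n - 2) + 1 by omega, pow_succ]
        refine lt_of_le_of_lt ?_ ih
        have : (10 / 9 * ((n+1:ℕ):ℝ)) ^ 2 * 0.41 ≤ (10 / 9 * (n:ℝ)) ^ 2 := by push_cast; nlinarith
        calc (10 / 9 * ((n+1:ℕ):ℝ)) ^ 2 * (0.41 ^ (n-2) * 0.41) = (10 / 9 * ((n+1:ℕ):ℝ)) ^ 2 * 0.41 * 0.41 ^ (n-2) := by ring
          _ ≤ _ := by gcongr
    refine lt_of_le_of_lt ?_ (hfin k h10')
    gcongr
end XS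

namespace XS
open Real

lemma EY_small_sq {k : ℕ} (hk : 4 ≤ k) {m n ℓ : ℕ} (hℓ : 2 ≤ ℓ) (hm : 0 < m) (hmn : m ≤ n)
    (hα : (ℓ:ℝ) ≤ 1 / (max 10 k : ℝ) * m) :
    EY k m n ℓ ^ 2 ≤ exp 1 * (k * ℓ) * (D0 k ^ 2 * (D0 k * (ℓ / m) / exp 1) ^ (k-2)) ^ ℓ := by
  have hm0 : (0:ℝ) < m := by exact_mod_cast hm
  have hℓ0 : (0:ℝ) < ℓ := by exact_mod_cast (by omega : 0 < ℓ)
  have hk0 : (0:ℝ) < k := by exact_mod_cast (by omega : 0 < k)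
  have hmx : (10:ℝ) ≤ max 10 (k:ℝ) := le_max_left _ _
  have hα1 : 1 / (max 10 k : ℝ) ≤ 1 / 10 := by gcongr
  have h1 : 0 < 1 - 1 / (max 10 k : ℝ) := by linarith
  have hD : 0 < D0 k := by unfold D0; positivity
  have hlm' : (ℓ:ℝ) < m := by nlinarith
  have hlm : ℓ < m := by exact_mod_cast hlm'
  obtain ⟨T, hT⟩ := exists_T (k := k) hlm.le
  have hR : 0 ≤ exp 1 * (k * ℓ) * (D0 k ^ 2 * (D0 k * (ℓ / m) / exp 1) ^ (k-2)) ^ ℓ := by positivity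
  rw [EY_eq T hT]
  by_cases hev : Even T.card
  swap
  · rw [EC_odd hev]; simpa using hR
  obtain ⟨s, hs⟩ := hev
  have hs2 : T.card = 2 * s := by omega
  have hkl : k * ℓ = 2 * s := by omega
  have hcard : Fintype.card (Fin m × Fin k) = m * k := by simp
  have hKlt : k * ℓ < Fintype.card (Fin m × Fin k) := by
    rw [hcard, mul_comm m k]; exact Nat.mul_lt_mul_of_pos_left hlm (by omega)
  have hsw := switch_main (n := n) (by omega) hKlt s hkl.ge T hs2
  rw [hcard] at hsw
  set B : ℝ := 1 / n + 1 / ((m * k : ℕ) - (k * ℓ : ℕ) : ℝ) with hB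
  have hB0 : 0 ≤ B := by
    have : (0:ℝ) ≤ ((m * k : ℕ) - (k * ℓ : ℕ) : ℝ) := by push_cast; nlinarith
    positivity
  have hBle : B ≤ D0 k / (k * m) := by
    have e1 : (1:ℝ) / n ≤ 1 / m := by
      have : (m:ℝ) ≤ n := by exact_mod_cast hmn
      gcongr
    have e2 : (1:ℝ) / ((m * k : ℕ) - (k * ℓ : ℕ) : ℝ) ≤ 1 / (k * m * (1 - 1 / (max 10 k : ℝ))) := by
      apply one_div_le_one_div_of_le (by positivity)
      push_cast
      nlinarith [mul_le_mul_of_nonneg_left hα hk0.le]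
    have e3 : D0 k / (k * m) = 1 / m + 1 / (k * m * (1 - 1 / (max 10 k : ℝ))) := by
      unfold D0
      field_simp
    rw [e3]; linarith
  set Cn : ℝ := ((CC (Fin m × Fin k) n).card : ℝ) with hCn
  have hle : (m.choose ℓ : ℝ) * EC n T / Cn ≤ m.choose ℓ * (((2 * s - 1).doubleFactorial : ℕ) * B ^ s) := by
    apply div_le_of_le_mul₀ (by positivity) (by positivity)
    rw [mul_assoc]
    gcongr
  have h0 : 0 ≤ (m.choose ℓ : ℝ) * EC n T / Cn := by positivity
  have hf := fact_upper (k * ℓ) (by nlinarith)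
  have hd := dfact_sq s
  rw [← hkl] at hd
  have hc := choose_upper m ℓ (by omega)
  obtain ⟨j, rfl⟩ : ∃ j, k = j + 2 := ⟨k - 2, by omega⟩
  calc ((m.choose ℓ : ℝ) * EC n T / Cn) ^ 2 ≤ (m.choose ℓ * (((2 * s - 1).doubleFactorial : ℕ) * B ^ s)) ^ 2 := by gcongr
    _ = (m.choose ℓ : ℝ) ^ 2 * (((2 * s - 1).doubleFactorial : ℕ) : ℝ) ^ 2 * B ^ (2 * s) := by ring
    _ ≤ ((exp 1 * m / ℓ) ^ ℓ) ^ 2 * (exp 1 * ((j+2) * ℓ : ℕ) * (((j+2) * ℓ : ℕ) / exp 1) ^ ((j+2) * ℓ)) * (D0 (j+2) / ((j+2 : ℕ) * m)) ^ (2 * s) := by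
      gcongr
      · rw [← hkl]; exact hd.trans hf
    _ = _ := by
      rw [← hkl, Nat.add_sub_cancel]
      push_cast
      rw [pow_mul _ (j+2) ℓ, pow_mul _ (j+2) ℓ, ← pow_mul _ ℓ 2, mul_comm ℓ 2, pow_mul _ 2 ℓ]
      have : ∀ a b c d : ℝ, a ^ ℓ * (b * c ^ ℓ) * d ^ ℓ = b * (a * c * d) ^ ℓ := by
        intro a b c d; rw [mul_pow, mul_pow]; ring
      rw [this]
      congr 2
      rw [← hs2] at *
      push_cast at hk0
      generalize D0 (j+2) = D
      have : exp 1 ≠ 0 := (exp_pos 1).ne'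
      have : (j:ℝ) + 2 ≠ 0 := hk0.ne'
      rw [mul_assoc, ← mul_pow]
      have : ((j:ℝ)+2) * ℓ / exp 1 * (D / ((j+2) * m)) = D * (ℓ / m) / exp 1 := by field_simp
      rw [this, pow_add]
      field_simp

lemma EY_small {k : ℕ} (hk : 4 ≤ k) : ∃ C ρ : ℝ, 0 ≤ C ∧ 0 < ρ ∧ ρ < 1 ∧ ∀ m n ℓ : ℕ, 2 ≤ ℓ → 0 < m → m ≤ n →
    (ℓ:ℝ) ≤ 1 / (max 10 k : ℝ) * m → EY k m n ℓ ≤ C * ((ℓ:ℝ) ^ (k-1) * ρ ^ ℓ) / (m:ℝ) ^ (k-2) := by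
  have hmx : (10:ℝ) ≤ max 10 (k:ℝ) := le_max_left _ _
  have hα1 : 1 / (max 10 k : ℝ) ≤ 1 / 10 := by gcongr
  have h1 : 0 < 1 - 1 / (max 10 k : ℝ) := by linarith
  have hk0 : (0:ℝ) < k := by exact_mod_cast (by omega : 0 < k)
  have hD : 0 < D0 k := by unfold D0; positivity
  have hr := r_lt_one hk
  set r := D0 k ^ 2 * (D0 k * (1 / (max 10 k : ℝ)) / exp 1) ^ (k - 2) with hrdef
  have hr0 : 0 < r := by positivity
  refine ⟨√(exp 1 * k * (D0 k ^ 2 * (D0 k / exp 1) ^ (k-2)) ^ 2) / r, √r, by positivity, by positivity, ?_, ?_⟩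
  · rw [Real.sqrt_lt' one_pos]; simpa using hr
  intro m n ℓ hℓ hm hmn hα
  have hm0 : (0:ℝ) < m := by exact_mod_cast hm
  have hℓ1 : (1:ℝ) ≤ ℓ := by exact_mod_cast (by omega : 1 ≤ ℓ)
  apply le_of_sq_le_sq _ (by positivity)
  refine (EY_small_sq hk hℓ hm hmn hα).trans ?_
  set Q := D0 k ^ 2 * (D0 k * (ℓ / m) / exp 1) ^ (k-2) with hQ
  have hQr : Q ≤ r := by
    have : (ℓ / m : ℝ) ≤ 1 / (max 10 k : ℝ) := by rw [div_le_iff₀ hm0]; exact hα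
    rw [hQ, hrdef]; gcongr
  have hQ0 : 0 ≤ Q := by positivity
  have e1 : Q = (D0 k ^ 2 * (D0 k / exp 1) ^ (k-2)) * (ℓ:ℝ) ^ (k-2) / (m:ℝ) ^ (k-2) := by
    rw [hQ, show D0 k * (ℓ / m : ℝ) / exp 1 = D0 k / exp 1 * ℓ / m by ring, div_pow _ (m:ℝ), mul_pow]
    ring
  have e2 : Q ^ ℓ ≤ Q ^ 2 * r ^ ℓ / r ^ 2 := by
    obtain ⟨i, rfl⟩ : ∃ i, ℓ = i + 2 := ⟨ℓ - 2, by omega⟩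
    have : Q ^ i ≤ r ^ i := by gcongr
    rw [pow_add, pow_add, mul_div_assoc, mul_div_cancel_right₀ _ (by positivity), mul_comm]
    gcongr
  calc exp 1 * (k * ℓ) * Q ^ ℓ ≤ exp 1 * (k * ℓ) * (Q ^ 2 * r ^ ℓ / r ^ 2) := by gcongr
    _ ≤ exp 1 * (k * (ℓ:ℝ)^2) * (Q ^ 2 * r ^ ℓ / r ^ 2) := by
      gcongr; nlinarith
    _ = _ := by
      have hX : 0 ≤ exp 1 * k * (D0 k ^ 2 * (D0 k / exp 1) ^ (k-2)) ^ 2 := by positivity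
      rw [e1, show k - 1 = (k - 2) + 1 by omega]
      have s1 := Real.sq_sqrt hX
      have s2 : (√r ^ ℓ) ^ 2 = r ^ ℓ := by rw [← pow_mul, mul_comm, pow_mul, Real.sq_sqrt hr0.le]
      clear_value r
      generalize √(exp 1 * k * (D0 k ^ 2 * (D0 k / exp 1) ^ (k-2)) ^ 2) = Y at *
      generalize √r ^ ℓ = Z at *
      generalize D0 k ^ 2 * (D0 k / exp 1) ^ (k-2) = X at *
      rw [← s2]
      rw [show (Y / r * ((ℓ:ℝ) ^ (k - 2 + 1) * Z) / (m:ℝ) ^ (k - 2)) ^ 2 = Y ^ 2 * ((ℓ:ℝ) ^ (k - 2 + 1) * Z / r / (m:ℝ) ^ (k - 2)) ^ 2 by ring, s1]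
      field_simp
      try ring

lemma small_sum {k : ℕ} (hk : 4 ≤ k) : ∃ C : ℝ, ∀ m n : ℕ, 0 < m → m ≤ n →
    ∑ ℓ ∈ (Finset.Icc 2 m).filter (fun ℓ : ℕ => (ℓ:ℝ) ≤ 1 / (max 10 k : ℝ) * m), EY k m n ℓ ≤ C / (m:ℝ) ^ (k-2) := by
  obtain ⟨C, ρ, hC, hρ0, hρ1, h⟩ := EY_small hk
  have hsum := summable_pow_mul_geometric_of_norm_lt_one (R := ℝ) (k-1) (r := ρ) (by rw [norm_of_nonneg hρ0.le]; exact hρ1)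
  refine ⟨C * ∑' ℓ : ℕ, (ℓ:ℝ) ^ (k-1) * ρ ^ ℓ, fun m n hm hmn => ?_⟩
  calc _ ≤ ∑ ℓ ∈ (Finset.Icc 2 m).filter (fun ℓ : ℕ => (ℓ:ℝ) ≤ 1 / (max 10 k : ℝ) * m), C / (m:ℝ) ^ (k-2) * ((ℓ:ℝ) ^ (k-1) * ρ ^ ℓ) := by
        apply Finset.sum_le_sum
        intro ℓ hℓ
        rw [Finset.mem_filter, Finset.mem_Icc] at hℓ
        refine (h m n ℓ hℓ.1.1 hm hmn hℓ.2).trans (le_of_eq ?_)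
        ring
    _ = C / (m:ℝ) ^ (k-2) * ∑ ℓ ∈ (Finset.Icc 2 m).filter (fun ℓ : ℕ => (ℓ:ℝ) ≤ 1 / (max 10 k : ℝ) * m), ((ℓ:ℝ) ^ (k-1) * ρ ^ ℓ) := by
        rw [Finset.mul_sum]
    _ ≤ C / (m:ℝ) ^ (k-2) * ∑' ℓ : ℕ, (ℓ:ℝ) ^ (k-1) * ρ ^ ℓ := by
        gcongr
        exact hsum.sum_le_tsum _ (fun i _ => by positivity)
    _ = _ := by ring
end XS

namespace XS
open Real

lemma WW_step (n M : ℕ) : (n:ℝ) * WW n v2 M ≤ (M + 1) * WW n v2 (M + 1) := by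
  have h : n * (CC (Fin M) n).card ≤ (CC (Fin (M+1)) n).card := by
    have : n * (CC (Fin M) n).card = ((Finset.univ : Finset (Fin n)) ×ˢ CC (Fin M) n).card := by
      rw [Finset.card_product]; simp
    rw [this]
    apply Finset.card_le_card_of_injOn (fun p => (Fin.cons p.1 p.2 : Fin (M+1) → Fin n))
    · rintro ⟨i, φ⟩ hp
      simp only [Finset.mem_coe, Finset.mem_product, CC, Finset.mem_filter, Finset.mem_univ, true_and] at hp ⊢
      intro j
      refine (hp j).trans ?_
      unfold load
      apply Finset.card_le_card_of_injOn Fin.succ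
      · intro q hq
        simpa using hq
      · exact (Fin.succ_injective _).injOn
    · rintro ⟨i, φ⟩ _ ⟨i', φ'⟩ _ h
      have := Fin.cons_injective2 h
      exact Prod.ext this.1 this.2
  have h' : (n:ℝ) * (CC (Fin M) n).card ≤ (CC (Fin (M+1)) n).card := by exact_mod_cast h
  rw [card_CC, card_CC, Fintype.card_fin, Fintype.card_fin, Nat.factorial_succ] at h'
  push_cast at h'
  have hf : (0:ℝ) < M.factorial := by positivity
  nlinarith [h', mul_le_mul_of_nonneg_left h' (inv_nonneg.mpr hf.le), inv_mul_cancel₀ hf.ne']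

lemma WW_steps {n : ℕ} {l G : ℝ} (hl : 0 < l) (hG : 0 < G) (M d : ℕ) (hN : ((M + d : ℕ):ℝ) ≤ G * n) :
    (l / G) ^ d * (WW n v2 M * l ^ M) ≤ WW n v2 (M + d) * l ^ (M + d) := by
  induction d with
  | zero => simp
  | succ d ih =>
    have hN' : ((M + d : ℕ):ℝ) ≤ G * n := by push_cast at hN ⊢; linarith
    have h1 := ih hN'
    have hs := WW_step n (M + d)
    have hw := WW_nonneg (n := n) v2_nonneg (M + (d+1))
    have h2 : WW n v2 (M + d) ≤ G * WW n v2 (M + (d+1)) := by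
      by_cases hn : n = 0
      · subst hn
        have : ((M + (d+1) : ℕ):ℝ) ≤ 0 := by simpa using hN
        push_cast at this
        have : (0:ℝ) ≤ M := by positivity
        have : (0:ℝ) ≤ d := by positivity
        linarith
      · have hn' : (0:ℝ) < n := by exact_mod_cast Nat.pos_of_ne_zero hn
        have : (n:ℝ) * WW n v2 (M + d) ≤ n * (G * WW n v2 (M + (d+1))) := by
          refine hs.trans ?_
          rw [← mul_assoc]
          apply mul_le_mul_of_nonneg_right _ hw
          push_cast at hN ⊢; linarith
        exact le_of_mul_le_mul_left this hn'
    calc (l / G) ^ (d+1) * (WW n v2 M * l ^ M) = (l / G) * ((l / G) ^ d * (WW n v2 M * l ^ M)) := by ring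
      _ ≤ (l / G) * (WW n v2 (M + d) * l ^ (M + d)) := by gcongr
      _ ≤ (l / G) * ((G * WW n v2 (M + (d+1))) * l ^ (M + d)) := by gcongr
      _ = _ := by field_simp; ring

lemma tail {x η : ℝ} (s : ℝ) (hx : 0 < x) (hη : 0 < η) : ∃ σ > 0, ∀ n M : ℕ,
    η * n ≤ s * (M - gg x * n) → WW n v2 M * x ^ M ≤ ff x ^ n * exp (-(σ * n)) := by
  set H : ℝ → ℝ := fun t => log (ff (x * exp (s * t))) - t * (s * gg x + η) with hH
  have hd : HasDerivAt H (-η) 0 := by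
    have h1 : HasDerivAt (fun t : ℝ => x * exp (s * t)) (x * (exp (s * 0) * (s * 1))) 0 :=
      (((hasDerivAt_id (0:ℝ)).const_mul s).exp).const_mul x
    have h2 := (hasDerivAt_ff (x * exp (s * 0))).comp (0:ℝ) h1
    have hp : ff (x * exp (s * 0)) ≠ 0 := (ff_pos (by positivity)).ne'
    have h3 := (h2.log hp).sub ((hasDerivAt_id (0:ℝ)).mul_const (s * gg x + η))
    refine h3.congr_deriv ?_
    simp [gg]
    ring
  have hev : ∃ t > 0, H t < H 0 := by
    have h := (hasDerivAt_iff_tendsto_slope_zero.mp hd).eventually (gt_mem_nhds (show -η < 0 by linarith))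
    have h' : ∀ᶠ t in nhdsWithin (0:ℝ) (Set.Ioi 0), t⁻¹ • (H (0 + t) - H 0) < 0 :=
      h.filter_mono (nhdsWithin_mono _ (fun t ht => ne_of_gt ht))
    obtain ⟨t, ht, ht0⟩ := (h'.and self_mem_nhdsWithin).exists
    refine ⟨t, ht0, ?_⟩
    have ht0' : (0:ℝ) < t := ht0
    rw [smul_eq_mul, zero_add] at ht
    by_contra hc
    push Not at hc
    have : 0 ≤ t⁻¹ * (H t - H 0) := mul_nonneg (by positivity) (by linarith)
    linarith
  obtain ⟨t, ht0, ht⟩ := hev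
  refine ⟨H 0 - H t, by linarith, fun n M hM => ?_⟩
  have h0 : H 0 = log (ff x) := by simp [hH]
  set y := x * exp (s * t) with hy
  have hy0 : 0 < y := by positivity
  have hfy : 0 < ff y := ff_pos hy0.ne'
  have hfx : 0 < ff x := ff_pos hx.ne'
  have hHt : H t = log (ff y) - t * (s * gg x + η) := rfl
  have hu := WW_v2_le (n := n) (M := M) hy0.le
  have e1 : x ^ M = y ^ M * exp (-(t * (s * M))) := by
    rw [hy, mul_pow, ← exp_nat_mul, mul_assoc, ← exp_add]
    rw [show (M:ℝ) * (s * t) + -(t * (s * M)) = 0 by ring]; simp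
  calc WW n v2 M * x ^ M = (WW n v2 M * y ^ M) * exp (-(t * (s * M))) := by rw [e1]; ring
    _ ≤ ff y ^ n * exp (-(t * ((s * gg x + η) * n))) := by
      have : (s * gg x + η) * n ≤ s * M := by linarith
      apply mul_le_mul hu _ (exp_pos _).le (by positivity)
      apply exp_le_exp.mpr
      have := mul_le_mul_of_nonneg_left this ht0.le
      linarith
    _ = ff x ^ n * exp (-((H 0 - H t) * n)) := by
      rw [h0, hHt]
      rw [show ff y ^ n = exp (n * log (ff y)) by rw [exp_nat_mul, exp_log hfy],
        show ff x ^ n = exp (n * log (ff x)) by rw [exp_nat_mul, exp_log hfx], ← exp_add, ← exp_add]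
      congr 1; ring
end XS

namespace XS
open Real

lemma hasSum_v2 (x : ℝ) : HasSum (fun a : ℕ => v2 a * x ^ a) (ff x) := by
  have h := (hasSum_nat_add_iff (f := fun a : ℕ => v2 a * x ^ a) (g := ff x) 2).mp (by
    refine hs_congr (hasSum_ff x) (fun i => ?_) rfl
    simp [v2]; ring)
  simpa [Finset.sum_range_succ, v2] using h

lemma lin_exp (A : ℕ) {σ : ℝ} (hσ : 0 < σ) : ∀ᶠ n : ℕ in Filter.atTop, (n * A + 1 : ℝ) < exp (σ * n) := by
  have h := (isLittleO_pow_exp_pos_mul_atTop 1 hσ).comp_tendsto tendsto_natCast_atTop_atTop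
  have h2 := h.bound (show (0:ℝ) < 1 / (A + 2) by positivity)
  filter_upwards [h2, Filter.eventually_ge_atTop 1] with n hn hn1
  simp only [Function.comp, pow_one, norm_eq_abs, abs_exp] at hn
  rw [abs_of_nonneg (by positivity), div_mul_eq_mul_div, le_div_iff₀ (by positivity)] at hn
  have : (1:ℝ) ≤ n := by exact_mod_cast hn1
  nlinarith

lemma concentration {x η ε : ℝ} (hx : 0 < x) (hη : 0 < η) (hε : 0 < ε) : ∀ᶠ n : ℕ in Filter.atTop,
    ∃ M : ℕ, |(M:ℝ) - gg x * n| ≤ η * n ∧ ff x ^ n * exp (-(ε * n)) ≤ WW n v2 M * x ^ M := by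
  obtain ⟨σ1, hσ1, h1⟩ := tail 1 hx hη
  obtain ⟨σ2, hσ2, h2⟩ := tail (-1) hx hη
  set σ := min ε (min σ1 σ2) with hσ
  have hσ0 : 0 < σ := by simp [hσ, *]
  have hfx : 0 < ff x := ff_pos hx.ne'
  have hA : ∃ A : ℕ, ff x * exp (-(σ/2)) < ∑ a ∈ Finset.range (A + 1), v2 a * x ^ a := by
    have ht := ((hasSum_v2 x).tendsto_sum_nat.comp (Filter.tendsto_add_atTop_nat 1)).eventually
      (lt_mem_nhds (show ff x * exp (-(σ/2)) < ff x by
        have : exp (-(σ/2)) < 1 := (by rw [exp_lt_one_iff]; linarith)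
        nlinarith))
    exact ht.exists
  obtain ⟨A, hA⟩ := hA
  filter_upwards [lin_exp A (show 0 < σ/2 by positivity)] with n hn
  by_contra hcon
  push Not at hcon
  have hall : ∀ M : ℕ, WW n v2 M * x ^ M ≤ ff x ^ n * exp (-(σ * n)) := by
    intro M
    have hn0 : (0:ℝ) ≤ n := by positivity
    have mono : ∀ τ, σ ≤ τ → ff x ^ n * exp (-(τ * n)) ≤ ff x ^ n * exp (-(σ * n)) := by
      intro τ hτ; gcongr
    by_cases hM : |(M:ℝ) - gg x * n| ≤ η * n
    · exact (hcon M hM).le.trans (mono ε (min_le_left _ _))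
    · push Not at hM
      rcases lt_abs.mp hM with h | h
      · exact (h1 n M (by linarith)).trans (mono σ1 ((min_le_right _ _).trans (min_le_left _ _)))
      · exact (h2 n M (by linarith)).trans (mono σ2 ((min_le_right _ _).trans (min_le_right _ _)))
  have hlow := WW_lower (n := n) (v := fun a => v2 a * x ^ a) (fun a => mul_nonneg (v2_nonneg a) (by positivity)) A
  have : (ff x * exp (-(σ/2))) ^ n ≤ (n * A + 1) * (ff x ^ n * exp (-(σ * n))) := by
    calc (ff x * exp (-(σ/2))) ^ n ≤ (∑ a ∈ Finset.range (A + 1), v2 a * x ^ a) ^ n := by gcongr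
      _ ≤ _ := hlow
      _ ≤ ∑ M ∈ Finset.range (n * A + 1), ff x ^ n * exp (-(σ * n)) := by
        apply Finset.sum_le_sum
        intro M _
        rw [← WW_mul_pow]; exact hall M
      _ = _ := by rw [Finset.sum_const, Finset.card_range, nsmul_eq_mul]; push_cast; ring
  rw [mul_pow, ← exp_nat_mul] at this
  have e : exp (n * -(σ/2)) = exp (σ/2 * n) * exp (-(σ * n)) := by rw [← exp_add]; congr 1; ring
  rw [e] at this
  have hp : 0 < ff x ^ n * exp (-(σ * n)) := by positivity
  nlinarith

lemma denom {l δ : ℝ} (hl : 0 < l) (hδ : 0 < δ) : ∃ η > 0, ∀ᶠ n : ℕ in Filter.atTop, ∀ N : ℕ,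
    |(N:ℝ) - gg l * n| ≤ η * n → ff l ^ n * exp (-(δ * n)) ≤ WW n v2 N * l ^ N := by
  have hg := two_lt_gg hl
  have hlg := le_gg hl
  set G := gg l + 1 with hG
  have hG0 : 0 < G := by linarith
  set L := log (G / l) with hL
  have hL0 : 0 < L := log_pos (by rw [one_lt_div hl]; linarith)
  -- choose x < l
  have hfl : 0 < ff l := ff_pos hl.ne'
  set κ := min 1 (δ / (4 * L)) with hκ
  have hκ0 : 0 < κ := by positivity
  have hx : ∃ x, 0 < x ∧ x < l ∧ gg l - κ < gg x ∧ ff l * exp (-(δ/4)) < ff x := by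
    have c1 := (gg_contAt hl).eventually (lt_mem_nhds (show gg l - κ < gg l by linarith))
    have c2 := (ff_cont.continuousAt (x := l)).eventually (lt_mem_nhds (show ff l * exp (-(δ/4)) < ff l by
        have : exp (-(δ/4)) < 1 := (by rw [exp_lt_one_iff]; linarith)
        nlinarith))
    have c3 := lt_mem_nhds hl
    have c := ((c1.and c2).and c3).filter_mono (nhdsWithin_le_nhds (s := Set.Iio l))
    obtain ⟨x, ⟨⟨h1, h2⟩, h3⟩, h4⟩ := (c.and self_mem_nhdsWithin).exists
    exact ⟨x, h3, h4, h1, h2⟩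
  obtain ⟨x, hx0, hxl, hgx, hfx⟩ := hx
  have hgl : gg x < gg l := gg_strictMono hx0 hl hxl
  set η := min ((gg l - gg x) / 2) (min κ 1 / 2) with hη
  have hη0 : 0 < η := by
    have : 0 < gg l - gg x := by linarith
    positivity
  have hη1 : η ≤ (gg l - gg x) / 2 := min_le_left _ _
  have hη2 : η ≤ κ / 2 := (min_le_right _ _).trans (by gcongr; exact min_le_left _ _)
  have hη3 : η ≤ 1 / 2 := (min_le_right _ _).trans (by gcongr; exact min_le_right _ _)
  refine ⟨η, hη0, ?_⟩
  filter_upwards [concentration hx0 hη0 (show 0 < δ/4 by positivity)] with n hn N hN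
  obtain ⟨M, hM, hW⟩ := hn
  rw [abs_le] at hM hN
  have hn0 : (0:ℝ) ≤ n := by positivity
  have hMN' : (M:ℝ) ≤ N := by nlinarith
  have hMN : M ≤ N := by exact_mod_cast hMN'
  obtain ⟨d, rfl⟩ := Nat.exists_eq_add_of_le hMN
  have hd : (d:ℝ) ≤ 2 * κ * n := by push_cast at hN; nlinarith
  have hst := WW_steps (n := n) hl hG0 M d (by nlinarith)
  refine le_trans ?_ hst
  have e1 : exp (-(δ/2 * n)) ≤ (l / G) ^ d := by
    have : l / G = exp (-L) := by rw [hL, exp_neg, exp_log (by positivity)]; field_simp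
    rw [this, ← exp_nat_mul]
    apply exp_le_exp.mpr
    have h1 : d * L ≤ 2 * κ * n * L := by gcongr
    have h2 : κ * L ≤ δ / 4 := by
      have : κ ≤ δ / (4 * L) := min_le_right _ _
      rw [le_div_iff₀ (by positivity)] at this
      linarith
    nlinarith
  have e2 : ff l ^ n * exp (-(δ/4*n)) ≤ ff x ^ n := by
    have : (ff l * exp (-(δ/4))) ^ n ≤ ff x ^ n := by gcongr
    rw [mul_pow, ← exp_nat_mul] at this
    convert this using 3; ring
  have e3 : WW n v2 M * x ^ M ≤ WW n v2 M * l ^ M := by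
    have := WW_nonneg (n := n) v2_nonneg M
    gcongr
  calc ff l ^ n * exp (-(δ * n)) = exp (-(δ/2 * n)) * (ff l ^ n * exp (-(δ/4*n)) * exp (-(δ/4*n))) := by
        rw [mul_assoc (ff l ^ n), ← exp_add, mul_left_comm, ← exp_add]; congr 2; ring
    _ ≤ (l / G) ^ d * (ff x ^ n * exp (-(δ/4*n))) := by gcongr
    _ ≤ (l / G) ^ d * (WW n v2 M * l ^ M) := mul_le_mul_of_nonneg_left (hW.trans e3) (by positivity)
end XS

namespace XS
open Real

lemma pp_eq {m ℓ : ℕ} (hℓ : 1 ≤ ℓ) (hℓm : ℓ ≤ m) {a : ℝ} (ha : 0 < a) (ha1 : a < 1 ∨ (a = 1 ∧ ℓ = m)) :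
    a ^ ℓ * (1 - a) ^ (m - ℓ) = exp (m * ((ℓ/m:ℝ) * log a + (1 - ℓ/m) * log (1 - a))) := by
  have hm : (0:ℝ) < m := by exact_mod_cast (by omega : 0 < m)
  have e : (m:ℝ) * ((ℓ/m:ℝ) * log a + (1 - ℓ/m) * log (1 - a)) = ℓ * log a + ((m - ℓ : ℕ):ℝ) * log (1 - a) := by
    rw [Nat.cast_sub hℓm]; field_simp
  rw [e, exp_add, exp_nat_mul, exp_nat_mul, exp_log ha]
  rcases ha1 with h | ⟨h, h'⟩
  · rw [exp_log (by linarith)]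
  · subst h'; simp

lemma binEnt (p : ℝ) : p * log p + (1 - p) * log (1 - p) = - binEntropy p := by
  rw [binEntropy_eq_negMulLog_add_negMulLog_one_sub, negMulLog, negMulLog]; ring

lemma pp_self {m ℓ : ℕ} (hℓ : 1 ≤ ℓ) (hℓm : ℓ ≤ m) :
    (ℓ/m:ℝ) ^ ℓ * (1 - ℓ/m) ^ (m - ℓ) = exp (-(m * binEntropy (ℓ/m))) := by
  have hm : (0:ℝ) < m := by exact_mod_cast (by omega : 0 < m)
  have hl : (0:ℝ) < ℓ := by exact_mod_cast hℓ
  rw [pp_eq hℓ hℓm (by positivity), binEnt]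
  · congr 1; ring
  · rcases hℓm.lt_or_eq with h | h
    · left; rw [div_lt_one hm]; exact_mod_cast h
    · right; subst h; exact ⟨div_self hm.ne', rfl⟩

lemma choose_le_ent {m ℓ : ℕ} (hℓ : 1 ≤ ℓ) (hℓm : ℓ ≤ m) : (m.choose ℓ : ℝ) ≤ exp (m * binEntropy (ℓ/m)) := by
  have hm : (0:ℝ) < m := by exact_mod_cast (by omega : 0 < m)
  have hle : (ℓ/m:ℝ) ≤ 1 := by rw [div_le_one hm]; exact_mod_cast hℓm
  have h1 : (ℓ/m:ℝ) ^ ℓ * (1 - ℓ/m) ^ (m - ℓ) * m.choose ℓ ≤ 1 := by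
    have h := add_pow (ℓ/m:ℝ) (1 - ℓ/m) m
    rw [add_sub_cancel, one_pow] at h
    have h0 : (0:ℝ) ≤ 1 - ℓ/m := by linarith
    refine le_trans ?_ h.symm.le
    exact Finset.single_le_sum (f := fun i => (ℓ/m:ℝ) ^ i * (1 - ℓ/m) ^ (m - i) * m.choose i) (fun i _ => by positivity) (Finset.mem_range.mpr (Nat.lt_succ_of_le hℓm))
  rw [pp_self hℓ hℓm, exp_neg, inv_mul_le_iff₀ (exp_pos _)] at h1
  linarith

lemma fact_upper' (n : ℕ) : (n.factorial : ℝ) ≤ exp 1 * (n + 1) * (n / exp 1) ^ n := by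
  rcases n with _ | n
  · simp
  · refine (fact_upper (n+1) (by omega)).trans ?_
    gcongr; linarith

lemma choose_ge_ent {N K : ℕ} (hK : 1 ≤ K) (hKN : K ≤ N) :
    exp (N * binEntropy (K/N)) ≤ N.choose K * (exp 1 ^ 2 * (N + 1) ^ 2) := by
  have hN0 : (0:ℝ) < N := by exact_mod_cast (by omega : 0 < N)
  have hp := pp_self hK hKN
  have h1 := fact_upper' K
  have h2 := fact_upper' (N - K)
  have h3 := fact_lower N
  have hc : (N.choose K : ℝ) * K.factorial * (N-K).factorial = N.factorial := by
    exact_mod_cast Nat.choose_mul_factorial_mul_factorial hKN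
  have hKle : (K:ℝ) ≤ N := by exact_mod_cast hKN
  have hsub : ((N - K : ℕ):ℝ) = N - K := Nat.cast_sub hKN
  have key : ((N:ℝ) / exp 1) ^ N ≤ N.choose K * (exp 1 ^ 2 * (N + 1) ^ 2) * (((K:ℝ) / exp 1) ^ K * (((N - K : ℕ):ℝ) / exp 1) ^ (N-K)) := by
    refine h3.trans ?_
    rw [← hc]
    calc (N.choose K : ℝ) * K.factorial * (N-K).factorial ≤ N.choose K * (exp 1 * (K + 1) * (K / exp 1) ^ K) * (exp 1 * ((N - K : ℕ) + 1) * ((N - K : ℕ) / exp 1) ^ (N-K)) := by gcongr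
      _ ≤ N.choose K * (exp 1 * (N + 1) * (K / exp 1) ^ K) * (exp 1 * (N + 1) * ((N - K : ℕ) / exp 1) ^ (N-K)) := by
        have : ((N - K : ℕ):ℝ) ≤ N := by rw [hsub]; have : (0:ℝ) ≤ K := by positivity
                                         linarith
        gcongr
      _ = _ := by ring
  have e : ((K:ℝ) / exp 1) ^ K * (((N - K : ℕ):ℝ) / exp 1) ^ (N-K) = ((N:ℝ) / exp 1) ^ N * exp (-(N * binEntropy (K/N))) := by
    rw [← hp]
    have a1 : (K:ℝ) / exp 1 = (N:ℝ) / exp 1 * (K / N) := by field_simp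
    have a2 : ((N - K : ℕ):ℝ) / exp 1 = (N:ℝ) / exp 1 * (1 - K / N) := by rw [hsub]; field_simp
    rw [a1, a2, mul_pow, mul_pow]
    have a3 : ((N:ℝ) / exp 1) ^ N = ((N:ℝ) / exp 1) ^ K * ((N:ℝ) / exp 1) ^ (N - K) := by
      rw [← pow_add]; congr 1; omega
    rw [a3]; ring
  rw [e] at key
  have hpos : 0 < ((N:ℝ) / exp 1) ^ N := by positivity
  have key2 : 1 ≤ N.choose K * (exp 1 ^ 2 * (N + 1) ^ 2) * exp (-(N * binEntropy (K/N))) := by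
    refine le_of_mul_le_mul_left ?_ hpos
    linarith
  rw [exp_neg, ← div_eq_mul_inv, le_div_iff₀ (exp_pos _)] at key2
  linarith

lemma EY_large {k : ℕ} (hk : 4 ≤ k) {l c : ℝ} (hl : 0 < l) (hck : gg l = k * c) (hc : c < 1) :
    ∃ τ > 0, ∃ ε > 0, ∀ᶠ n : ℕ in Filter.atTop, ∀ m ℓ : ℕ, 0 < m → |(m:ℝ) / n - c| ≤ ε →
      1 / (max 10 k : ℝ) * m < ℓ → ℓ ≤ m → EY k m n ℓ ≤ exp 1 ^ 2 * ((m * k : ℕ) + 1) ^ 2 * exp (-(τ * n)) := by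
  have hk0 : (0:ℝ) < k := by exact_mod_cast (by omega : 0 < k)
  obtain ⟨δ, hδ, B, hpsi⟩ := psi_unif hk hl hck hc
  obtain ⟨η, hη, hden⟩ := denom hl (show 0 < δ/4 by positivity)
  set B' := max B 0 with hB'
  have hB0 : 0 ≤ B' := le_max_right _ _
  set ε := min (η / k) (δ / 4 / (1 + k * B')) with hε
  have hε0 : 0 < ε := by positivity
  refine ⟨δ/2, by positivity, ε, hε0, ?_⟩
  filter_upwards [hden, Filter.eventually_ge_atTop 1] with n hden hn1 m ℓ hm hmn hℓ hℓm
  have hn0 : (0:ℝ) < n := by exact_mod_cast hn1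
  have hm0 : (0:ℝ) < m := by exact_mod_cast hm
  have hmx : (10:ℝ) ≤ max 10 (k:ℝ) := le_max_left _ _
  have hℓ0' : (0:ℝ) < ℓ := lt_trans (by positivity) hℓ
  have hℓ0 : 1 ≤ ℓ := by exact_mod_cast hℓ0'
  obtain ⟨a, ha0, ha1, hps, hDD⟩ := hpsi (ℓ/m) ⟨by rw [le_div_iff₀ hm0]; exact hℓ.le, by
    rw [div_le_one hm0]; exact_mod_cast hℓm⟩
  obtain ⟨T, hT⟩ := exists_T (k := k) hℓm
  have hcard : Fintype.card (Fin m × Fin k) = m * k := by simp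
  have hup := EC_upper (n := n) T ha0 ha1 hl
  have hcc := card_CC (ι := Fin m × Fin k) n
  rw [hcard, hT] at hup
  rw [hcard] at hcc
  rw [EY_eq T hT]
  set N := m * k with hN
  set K := k * ℓ with hKd
  have hNm : (N:ℝ) = m * k := by rw [hN]; push_cast; ring
  have hKN : K ≤ N := by rw [hKd, hN, mul_comm m k]; exact Nat.mul_le_mul_left _ hℓm
  have hK1 : 1 ≤ K := Nat.mul_pos (by omega) hℓ0
  have hα : (K:ℝ) / N = ℓ / m := by rw [hNm, hKd]; push_cast; field_simp
  have hdN := hden N (by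
    have h1 : |(N:ℝ) - gg l * n| = k * n * |(m:ℝ) / n - c| := by
      rw [hck, hNm]
      rw [show (m:ℝ) * k - k * c * n = k * n * (m / n - c) by field_simp, abs_mul, abs_of_pos (by positivity)]
    rw [h1]
    have h2 : ε ≤ η / k := min_le_left _ _
    rw [le_div_iff₀ hk0] at h2
    calc k * n * |(m:ℝ) / n - c| ≤ k * n * ε := by gcongr
      _ = (ε * k) * n := by ring
      _ ≤ η * n := by gcongr)
  have hff : 0 < ff l := ff_pos hl.ne'
  set Cn : ℝ := ((CC (Fin m × Fin k) n).card : ℝ) with hCn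
  have hNf : (0:ℝ) < N.factorial := by positivity
  have hCpos : 0 < Cn := by
    rw [hcc]
    have : 0 < WW n v2 N * l ^ N := lt_of_lt_of_le (by positivity) hdN
    have := pos_of_mul_pos_left this (by positivity)
    positivity
  set R := (1 + RR l (1 - 2 * a)) / 2 with hR
  have hRpos : 0 < R := by have := RR_nonneg l (1 - 2*a); positivity
  have hRe : (ff l + ff ((1 - 2 * a) * l)) / 2 = ff l * R := by
    rw [hR, RR]; field_simp
  rw [hRe, mul_pow] at hup
  have hup2 : (N.choose K : ℝ) * (a ^ K * (1 - a) ^ (N - K)) * EC n T ≤ Cn * exp (δ/4 * n) * R ^ n := by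
    refine hup.trans ?_
    rw [← mul_assoc]
    apply mul_le_mul_of_nonneg_right _ (by positivity)
    rw [hcc, div_mul_eq_mul_div, div_le_iff₀ (by positivity)]
    have : ff l ^ n ≤ WW n v2 N * l ^ N * exp (δ/4 * n) := by
      rw [exp_neg, ← div_eq_mul_inv, div_le_iff₀ (exp_pos _)] at hdN
      exact hdN
    calc (N.factorial : ℝ) * ff l ^ n ≤ N.factorial * (WW n v2 N * l ^ N * exp (δ/4 * n)) := by gcongr
      _ = _ := by ring
  rw [pp_eq hK1 hKN ha0 (Or.inl ha1)] at hup2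
  have hge := choose_ge_ent hK1 hKN
  have hle := choose_le_ent hℓ0 hℓm
  rw [hα] at hup2 hge
  set α : ℝ := ℓ / m with hαd
  set S : ℝ := α * log a + (1 - α) * log (1 - a) with hS
  have hDDS : DD α a = - binEntropy α - S := by unfold DD; rw [hS]; ring
  set P : ℝ := exp 1 ^ 2 * (N + 1) ^ 2 with hP
  have hPpos : 0 < P := by positivity
  have hEC : (EC n T : ℝ) ≤ P * Cn * exp (δ/4 * n) * R ^ n * exp (N * DD α a) := by
    have h1 : exp (N * binEntropy α) * (exp (N * S) * EC n T) ≤ P * (Cn * exp (δ/4 * n) * R ^ n) := by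
      calc exp (N * binEntropy α) * (exp (N * S) * EC n T) ≤ (N.choose K * P) * (exp (N * S) * EC n T) := by gcongr
        _ = P * (N.choose K * exp (N * S) * EC n T) := by ring
        _ ≤ _ := by gcongr
    have h2 : exp (N * DD α a) * (exp (N * binEntropy α) * (exp (N * S) * EC n T)) = EC n T := by
      rw [← mul_assoc, ← mul_assoc, ← exp_add, ← exp_add, hDDS,
        show N * (-binEntropy α - S) + N * binEntropy α + N * S = 0 by ring, exp_zero, one_mul]
    rw [← h2]
    calc _ ≤ exp (N * DD α a) * (P * (Cn * exp (δ/4 * n) * R ^ n)) := by gcongr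
      _ = _ := by ring
  rw [div_le_iff₀ hCpos]
  have hRn : R ^ n = exp (n * log R) := by rw [exp_nat_mul, exp_log hRpos]
  have hmain : m * binEntropy α + (δ/4 * n + n * log R + N * DD α a) ≤ -(δ/2 * n) := by
    have hpsi' : c * binEntropy α + k * c * DD α a + log R ≤ -δ := by
      have := hps; unfold psi at this; rw [hck] at this; exact this
    set e := (m:ℝ) / n - c with he
    have hme : (m:ℝ) = n * (c + e) := by rw [he]; field_simp; ring
    have hb : e * binEntropy α ≤ ε := by
      have h0 : 0 ≤ binEntropy α := binEntropy_nonneg (by positivity) (by rw [hαd, div_le_one hm0]; exact_mod_cast hℓm)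
      have h1 : binEntropy α ≤ 1 := binEntropy_le_log_two.trans (by linarith [Real.log_two_lt_d9])
      calc e * binEntropy α ≤ |e| * binEntropy α := by gcongr; exact le_abs_self e
        _ ≤ ε * 1 := by gcongr
        _ = ε := mul_one _
    have hd : e * DD α a ≤ ε * B' := by
      calc e * DD α a ≤ |e * DD α a| := le_abs_self _
        _ = |e| * |DD α a| := abs_mul _ _
        _ ≤ ε * B' := by gcongr; exact hDD.trans (le_max_left _ _)
    have hεle : ε * (1 + k * B') ≤ δ / 4 := by
      have : ε ≤ δ / 4 / (1 + k * B') := min_le_right _ _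
      rwa [le_div_iff₀ (by positivity)] at this
    have hsum : (c + e) * binEntropy α + (δ/4 + log R + (c + e) * k * DD α a) ≤ -(δ/2) := by
      have := mul_le_mul_of_nonneg_left hd hk0.le
      linarith
    rw [hNm, hme]
    have := mul_le_mul_of_nonneg_left hsum hn0.le
    linarith
  calc (m.choose ℓ : ℝ) * EC n T ≤ exp (m * binEntropy α) * (P * Cn * exp (δ/4 * n) * R ^ n * exp (N * DD α a)) := by gcongr
    _ = P * Cn * exp (m * binEntropy α + (δ/4 * n + n * log R + N * DD α a)) := by
      rw [hRn, exp_add, exp_add, exp_add]; ring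
    _ ≤ P * Cn * exp (-(δ/2 * n)) := by gcongr
    _ = _ := by ring
end XS

namespace XS
open Real

lemma pow_exp (p : ℕ) (C : ℝ) {τ : ℝ} (hτ : 0 < τ) : ∀ᶠ n : ℕ in Filter.atTop, C * (n:ℝ) ^ p * exp (-(τ * n)) ≤ 1 := by
  have h := (isLittleO_pow_exp_pos_mul_atTop p hτ).comp_tendsto tendsto_natCast_atTop_atTop
  have h2 := h.bound (show (0:ℝ) < 1 / (|C| + 1) by positivity)
  filter_upwards [h2] with n hn
  simp only [Function.comp, norm_eq_abs, abs_exp] at hn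
  rw [abs_of_nonneg (by positivity), div_mul_eq_mul_div, le_div_iff₀ (by positivity)] at hn
  rw [exp_neg, ← div_eq_mul_inv, div_le_one (exp_pos _)]
  have : C * (n:ℝ) ^ p ≤ |C| * (n:ℝ) ^ p := by gcongr; exact le_abs_self C
  have : (0:ℝ) ≤ (n:ℝ) ^ p := by positivity
  linarith
end XS

theorem sum_expected_critical_sets
    (k : ℕ) (hk : 4 ≤ k) (m n : ℕ → ℕ)
    (hm : ∀ j, 0 < m j) (hn : ∀ j, 0 < n j)
    (hmtop : Filter.Tendsto m Filter.atTop Filter.atTop)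
    (hntop : Filter.Tendsto n Filter.atTop Filter.atTop)
    (c : ℝ) (hc : 2 / k < c) (hc1 : c < 1)
    (hratio : Filter.Tendsto (fun j => (m j : ℝ) / (n j : ℝ)) Filter.atTop (nhds c)) :
    ∃ K : ℝ, ∀ᶠ j in Filter.atTop,
      ∑ ℓ ∈ Finset.Icc 2 (m j), EY k (m j) (n j) ℓ ≤ K / (m j : ℝ) ^ (k - 2) := by
  have hk0 : (0:ℝ) < k := by exact_mod_cast (by omega : 0 < k)
  have hG : 2 < k * c := by rw [div_lt_iff₀ hk0] at hc; linarith
  obtain ⟨l, hl, hgl⟩ := XS.exists_gg hG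
  obtain ⟨C, hsmall⟩ := XS.small_sum hk
  obtain ⟨τ, hτ, ε, hε, hlarge⟩ := XS.EY_large hk hl hgl hc1
  refine ⟨C + 1, ?_⟩
  have r1 : ∀ᶠ j in Filter.atTop, |(m j : ℝ) / n j - c| ≤ ε := by
    filter_upwards [hratio.eventually (Metric.closedBall_mem_nhds c hε)] with j hj
    exact hj
  have r2 : ∀ᶠ j in Filter.atTop, (m j : ℝ) / n j < 1 := hratio.eventually (gt_mem_nhds hc1)
  have r3 := hntop.eventually hlarge
  have r4 := hntop.eventually (XS.pow_exp (k + 1) (Real.exp 1 ^ 2 * (k + 1) ^ 2) hτ)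
  filter_upwards [r1, r2, r3, r4] with j h1 h2 h3 h4
  have hmj : (0:ℝ) < m j := by exact_mod_cast hm j
  have hnj : (0:ℝ) < n j := by exact_mod_cast hn j
  rw [div_lt_one hnj] at h2
  have hmn : m j ≤ n j := by exact_mod_cast h2.le
  have hn1 : (1:ℝ) ≤ n j := by exact_mod_cast hn j
  rw [← Finset.sum_filter_add_sum_filter_not (Finset.Icc 2 (m j)) (fun ℓ : ℕ => (ℓ:ℝ) ≤ 1 / (max 10 k : ℝ) * m j), add_div]
  refine add_le_add (hsmall (m j) (n j) (hm j) hmn) ?_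
  set E := Real.exp 1 ^ 2 * ((m j * k : ℕ) + 1) ^ 2 * Real.exp (-(τ * n j)) with hE
  have hE0 : 0 ≤ E := by positivity
  calc _ ≤ ∑ ℓ ∈ (Finset.Icc 2 (m j)).filter (fun ℓ : ℕ => ¬ (ℓ:ℝ) ≤ 1 / (max 10 k : ℝ) * m j), E := by
        apply Finset.sum_le_sum
        intro ℓ hℓ
        rw [Finset.mem_filter, Finset.mem_Icc] at hℓ
        exact h3 (m j) ℓ (hm j) h1 (not_le.mp hℓ.2) hℓ.1.2
    _ ≤ m j * E := by
        rw [Finset.sum_const, nsmul_eq_mul]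
        gcongr
        refine (Finset.card_filter_le _ _).trans ?_
        simp
    _ ≤ 1 / (m j : ℝ) ^ (k - 2) := by
        rw [le_div_iff₀ (by positivity)]
        refine le_trans ?_ h4
        have hq : (((m j * k : ℕ):ℝ) + 1) ≤ (k + 1) * n j := by
          push_cast
          have : (m j : ℝ) * k ≤ n j * k := by gcongr
          linarith
        calc m j * E * (m j : ℝ) ^ (k - 2) ≤ n j * (Real.exp 1 ^ 2 * ((k + 1) * n j) ^ 2 * Real.exp (-(τ * n j))) * (n j : ℝ) ^ (k - 2) := by
              rw [hE]; gcongr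
          _ = _ := by
              obtain ⟨i, rfl⟩ : ∃ i, k = i + 2 := ⟨k - 2, by omega⟩
              rw [Nat.add_sub_cancel]
              push_cast
              ring
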